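/- Every orientation of a Lagrangian matroid M is induced from an orientation of its matroid polytope P (by the rule: s(F,F) = +1, bases joined by an inducing edge have opposite signs, bases joined by a non-inducing edge have equal signs), and this correspondence is one-to-one: orientations of the polytope P and orientations of M are in bijection. -/

import Mathlib

open Finset Matrix
open scoped Classical

/-- The index set `J = I ∪ I*`: the element `(i, false)` represents the unstarred
index `i+1`, and `(i, true)` represents the starred index `(i+1)*`. -/
abbrev JJ (n : ℕ) := Fin n × Bool

/-- The involution `* : J → J`. -/
def starJ {n : ℕ} (x : JJ n) : JJ n := (x.1, !x.2)

/-- A subset `A ⊆ J` is admissible iff `A ∩ A* = ∅`. -/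
def AdmissibleSet {n : ℕ} (A : Finset (JJ n)) : Prop := ∀ x ∈ A, starJ x ∉ A

/-- An admissible permutation of `J`: one commuting with `*`.  These form the
hyperoctahedral group `W = BC_n`. -/
def AdmissiblePerm {n : ℕ} (w : Equiv.Perm (JJ n)) : Prop := ∀ x, w (starJ x) = starJ (w x)

/-- The standard ordering `n* < … < 1* < 1 < … < n` on `J`, encoded by a value in `ℤ`. -/
def ordJ {n : ℕ} (x : JJ n) : ℤ := if x.2 then -((x.1 : ℤ) + 1) else (x.1 : ℤ) + 1

/-- The ordering `≤^w` on `J`: `x ≤^w y` iff `w⁻¹ x ≤ w⁻¹ y` in the standard order. -/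
def leW {n : ℕ} (w : Equiv.Perm (JJ n)) (x y : JJ n) : Prop :=
  ordJ (w.symm x) ≤ ordJ (w.symm y)

/-- The (Gale) ordering induced by `≤^w` on admissible subsets: `A ≼^w B` iff the
sorted lists dominate componentwise, equivalently iff there is a bijection
`f : A → B` with `a ≤^w f a` for all `a ∈ A`. -/
def setLE {n : ℕ} (w : Equiv.Perm (JJ n)) (A B : Finset (JJ n)) : Prop :=
  ∃ f : JJ n → JJ n, Set.BijOn f ↑A ↑B ∧ ∀ a ∈ A, leW w a (f a)

/-- `ℬ` is the collection of bases of a symplectic matroid of rank `k`: all members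
are admissible `k`-sets, and for every admissible permutation `w` there is a
(necessarily unique) `≤^w`-maximal member (the Maximality Property). -/
def IsSymplecticMatroid {n : ℕ} (k : ℕ) (ℬ : Finset (Finset (JJ n))) : Prop :=
  (∀ A ∈ ℬ, AdmissibleSet A ∧ A.card = k) ∧
  ∀ w : Equiv.Perm (JJ n), AdmissiblePerm w → ∃ A ∈ ℬ, ∀ B ∈ ℬ, setLE w B A

/-- A Lagrangian matroid is a symplectic matroid of rank `n`. -/
def IsLagrangianMatroid {n : ℕ} (ℬ : Finset (Finset (JJ n))) : Prop :=
  IsSymplecticMatroid n ℬ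
/-- The vector `e_j ∈ ℝ^n` for `j ∈ J`: `e_i` for unstarred `i`, `-e_i` for starred. -/
def eVec {n : ℕ} (x : JJ n) : Fin n → ℝ :=
  fun i => if i = x.1 then (if x.2 then -1 else 1) else 0

/-- The point `e_A = Σ_{j ∈ A} e_j ∈ ℝ^n` associated to an admissible set `A`. -/
def eSet {n : ℕ} (A : Finset (JJ n)) : Fin n → ℝ := ∑ x ∈ A, eVec x

/-- The matroid polytope: the convex hull of the points `e_A`, `A ∈ ℬ`. -/
def matroidPolytope {n : ℕ} (ℬ : Finset (Finset (JJ n))) : Set (Fin n → ℝ) :=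
  convexHull ℝ (eSet '' ↑ℬ)

/-- Bases `A` and `B` are joined by an edge of the matroid polytope: there is a linear
functional taking equal maximal values at `e_A`, `e_B` and strictly smaller values at
all other vertices. -/
def IsEdge {n : ℕ} (ℬ : Finset (Finset (JJ n))) (A B : Finset (JJ n)) : Prop :=
  A ∈ ℬ ∧ B ∈ ℬ ∧ A ≠ B ∧
  ∃ L : (Fin n → ℝ) →ₗ[ℝ] ℝ, L (eSet A) = L (eSet B) ∧
    ∀ C ∈ ℬ, C ≠ A → C ≠ B → L (eSet C) < L (eSet A)

/-- The height of `A` relative to the fundamental basis `F`: `h(A) = n - |A ∩ F|`. -/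
def heightF {n : ℕ} (F A : Finset (JJ n)) : ℕ := n - (A ∩ F).card

/-- A short edge: an edge whose ends are related by a short exchange `A = B ∆ {i,i*}`. -/
def IsShortEdge {n : ℕ} (ℬ : Finset (Finset (JJ n))) (A B : Finset (JJ n)) : Prop :=
  IsEdge ℬ A B ∧ ∃ i : JJ n, symmDiff A B = ({i, starJ i} : Finset (JJ n))

/-- A long edge: an edge whose ends are related by a long exchange
`A = B ∆ {i,i*,j,j*}`, `i ∉ {j,j*}`. -/
def IsLongEdge {n : ℕ} (ℬ : Finset (Finset (JJ n))) (A B : Finset (JJ n)) : Prop :=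
  IsEdge ℬ A B ∧ ∃ i j : JJ n, i ≠ j ∧ i ≠ starJ j ∧
    symmDiff A B = ({i, starJ i, j, starJ j} : Finset (JJ n))

/-- The four bases of a 2-dimensional face of the matroid polytope which is a square
with short edges (type sSquare): `A`, `A ∆ {i,i*}`, `A ∆ {j,j*}`, `A ∆ {i,i*,j,j*}`,
all of them bases. -/
def ShortSquare {n : ℕ} (ℬ : Finset (Finset (JJ n))) (v : Fin 4 → Finset (JJ n)) : Prop :=
  ∃ (A : Finset (JJ n)) (i j : JJ n), i.1 ≠ j.1 ∧
    v 0 = A ∧ v 1 = symmDiff A ({i, starJ i} : Finset (JJ n)) ∧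
    v 2 = symmDiff A ({j, starJ j} : Finset (JJ n)) ∧
    v 3 = symmDiff A ({i, starJ i, j, starJ j} : Finset (JJ n)) ∧
    ∀ k : Fin 4, v k ∈ ℬ

/-- `sF` is an orientation of the Lagrangian matroid with bases `ℬ` relative to the
fundamental basis `F`: it takes values `±1` on bases and satisfies axioms (i)–(iv). -/
def IsOrientationRel {n : ℕ} (ℬ : Finset (Finset (JJ n))) (F : Finset (JJ n))
    (sF : Finset (JJ n) → ℤ) : Prop :=
  (∀ A ∈ ℬ, sF A = 1 ∨ sF A = -1) ∧
  (∀ A B : Finset (JJ n), IsLongEdge ℬ A B → heightF F A = heightF F B → sF A = sF B) ∧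
  (∀ A B : Finset (JJ n), IsLongEdge ℬ A B → heightF F A ≠ heightF F B → sF A = -sF B) ∧
  (∀ v : Fin 4 → Finset (JJ n), ShortSquare ℬ v →
    ∀ k : Fin 4,
      ((∀ l m : Fin 4, l ≠ k → m ≠ k → sF (v l) = sF (v m)) ∧
        ∃ l : Fin 4, l ≠ k ∧ sF (v l) ≠ sF (v k)) →
      (∀ l : Fin 4, heightF F (v l) ≤ heightF F (v k)) ∨
      (∀ l : Fin 4, heightF F (v k) ≤ heightF F (v l))) ∧
  sF F = 1

/-- `(ℬ, s)` is an oriented Lagrangian matroid: `s` vanishes when an argument is not a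
basis, each `s G` is an orientation relative to `G`, and the change-of-fundamental-basis
rule holds. -/
def IsOrientation {n : ℕ} (ℬ : Finset (Finset (JJ n)))
    (s : Finset (JJ n) → Finset (JJ n) → ℤ) : Prop :=
  (∀ G A : Finset (JJ n), G ∉ ℬ ∨ A ∉ ℬ → s G A = 0) ∧
  (∀ G ∈ ℬ, IsOrientationRel ℬ G (s G)) ∧
  (∀ G ∈ ℬ, ∀ H ∈ ℬ, ∀ A ∈ ℬ, s G A = s H A * s H G * (-1) ^ ((G \ (H ∪ A)).card))
/-- An increasing path of length `p` in the matroid polytope starting at the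
fundamental basis `F`: consecutive vertices are joined by edges and strictly increase
for some linear functional compatible with the height relative to `F`. -/
def IncreasingPath {n : ℕ} (ℬ : Finset (Finset (JJ n))) (F : Finset (JJ n))
    (v : ℕ → Finset (JJ n)) (p : ℕ) : Prop :=
  v 0 = F ∧ (∀ i < p, IsEdge ℬ (v i) (v (i + 1))) ∧
  ∃ L : (Fin n → ℝ) →ₗ[ℝ] ℝ,
    (∀ A ∈ ℬ, ∀ B ∈ ℬ, heightF F B < heightF F A → L (eSet B) < L (eSet A)) ∧
    ∀ i < p, L (eSet (v i)) < L (eSet (v (i + 1)))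

/-- A height-increasing path: consecutive vertices are adjacent in the polytope and
the height relative to `F` strictly increases. -/
def HeightIncreasingPath {n : ℕ} (ℬ : Finset (Finset (JJ n))) (F : Finset (JJ n))
    (v : ℕ → Finset (JJ n)) (p : ℕ) : Prop :=
  v 0 = F ∧ ∀ i < p, IsEdge ℬ (v i) (v (i + 1)) ∧ heightF F (v i) < heightF F (v (i + 1))

/-- `A` is a basis of maximal height relative to `F`. -/
def MaxHeightBasis {n : ℕ} (ℬ : Finset (Finset (JJ n))) (F A : Finset (JJ n)) : Prop :=
  A ∈ ℬ ∧ ∀ B ∈ ℬ, heightF F B ≤ heightF F A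

/-- The number of changes of sign of `sF` along the path `v 0, v 1, …, v p`. -/
def signChanges {n : ℕ} (sF : Finset (JJ n) → ℤ) (v : ℕ → Finset (JJ n)) (p : ℕ) : ℕ :=
  ((Finset.range p).filter fun i => sF (v i) ≠ sF (v (i + 1))).card

/-- A 2-dimensional (exposed) face of the matroid polytope. -/
def Is2Face {n : ℕ} (ℬ : Finset (Finset (JJ n))) (Fc : Set (Fin n → ℝ)) : Prop :=
  IsExposed ℝ (matroidPolytope ℬ) Fc ∧ Module.finrank ℝ (vectorSpan ℝ Fc) = 2

/-- `v 0, …, v (m-1)` is the cycle of vertices (bases) of the 2-dimensional face `Fc`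
of the matroid polytope, consecutive ones (cyclically) being joined by edges. -/
def FaceCycle {n : ℕ} (ℬ : Finset (Finset (JJ n))) (Fc : Set (Fin n → ℝ)) (m : ℕ)
    (v : ℕ → Finset (JJ n)) : Prop :=
  Is2Face ℬ Fc ∧ 3 ≤ m ∧ (∀ i < m, v i ∈ ℬ ∧ eSet (v i) ∈ Fc) ∧
  (∀ A ∈ ℬ, eSet A ∈ Fc → ∃! i : ℕ, i < m ∧ v i = A) ∧
  ∀ i < m, IsEdge ℬ (v i) (v ((i + 1) % m))

/-- An orientation of the Lagrangian matroid polytope: an assignment `ε` of directions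
to short edges (`ε A B = 1` when the edge is directed from `A` to `B`; `ε` vanishes on
non-(short edges)) such that in every 2-dimensional face the number of short edges
directed clockwise equals the number directed anti-clockwise. -/
def IsPolytopeOrientation {n : ℕ} (ℬ : Finset (Finset (JJ n)))
    (ε : Finset (JJ n) → Finset (JJ n) → ℤ) : Prop :=
  (∀ A B : Finset (JJ n), IsShortEdge ℬ A B → (ε A B = 1 ∨ ε A B = -1) ∧ ε B A = -ε A B) ∧
  (∀ A B : Finset (JJ n), ¬IsShortEdge ℬ A B → ε A B = 0) ∧
  ∀ (Fc : Set (Fin n → ℝ)) (m : ℕ) (v : ℕ → Finset (JJ n)), FaceCycle ℬ Fc m v →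
    (∑ i ∈ Finset.range m, ε (v i) (v ((i + 1) % m))) = 0

/-- An inducing edge relative to `F`, for the polytope orientation `ε`: a vertical long
edge, or a short edge directed downwards (from the higher basis to the lower one). -/
def IsInducingEdge {n : ℕ} (ℬ : Finset (Finset (JJ n)))
    (ε : Finset (JJ n) → Finset (JJ n) → ℤ) (F A B : Finset (JJ n)) : Prop :=
  (IsLongEdge ℬ A B ∧ heightF F A ≠ heightF F B) ∨
  (IsShortEdge ℬ A B ∧
    ((heightF F B < heightF F A ∧ ε A B = 1) ∨ (heightF F A < heightF F B ∧ ε B A = 1)))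

/-- The signs `s` are induced from the polytope orientation `ε`: for every fundamental
basis `F`, `s F F = 1`, bases joined by an inducing edge get opposite signs, and bases
joined by a non-inducing edge get the same sign. -/
def InducedBy {n : ℕ} (ℬ : Finset (Finset (JJ n)))
    (ε : Finset (JJ n) → Finset (JJ n) → ℤ)
    (s : Finset (JJ n) → Finset (JJ n) → ℤ) : Prop :=
  ∀ F ∈ ℬ, s F F = 1 ∧ ∀ A B : Finset (JJ n), IsEdge ℬ A B →
    (IsInducingEdge ℬ ε F A B → s F A = -s F B) ∧
    (¬IsInducingEdge ℬ ε F A B → s F A = s F B)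


abbrev VV (n : ℕ) := Fin n → ZMod 2

def ee {n : ℕ} (i : Fin n) : VV n := fun k => if k = i then 1 else 0

lemma e2 {n : ℕ} (i : Fin n) : ee i + ee i = (0 : VV n) := by
  ext k; simp only [ee, Pi.add_apply, Pi.zero_apply]; split_ifs <;> decide

lemma z2_one {a b : ZMod 2} (h : a ≠ b) : a + 1 = b := by
  revert a b; decide

lemma z2_ne (a : ZMod 2) : a + 1 ≠ a := by
  revert a; decide

lemma ee_ne {n : ℕ} (X : VV n) {i k : Fin n} (h : k ≠ i) : (X + ee i) k = X k := by
  simp [ee, h]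

lemma ee_self {n : ℕ} (X : VV n) (i : Fin n) : (X + ee i) i = X i + 1 := by
  simp [ee]

lemma ee_self_ne {n : ℕ} (X : VV n) (i : Fin n) : (X + ee i) i ≠ X i := by
  rw [ee_self]; exact z2_ne _

lemma ee_cancel {n : ℕ} (X : VV n) (i : Fin n) : X + ee i + ee i = X := by
  linear_combination e2 i

def Exch {n : ℕ} (b : VV n → Prop) : Prop :=
  ∀ A B, b A → b B → ∀ i, A i ≠ B i →
    b (A + ee i) ∨ ∃ z, z ≠ i ∧ A z ≠ B z ∧ b (A + ee i + ee z)

structure GoodD {n : ℕ} (b : VV n → Prop) (δ : VV n → Fin n → ℤ) : Prop where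
  one : ∀ A i, b A → b (A + ee i) → δ A i * δ A i = 1
  symm : ∀ A i, b A → b (A + ee i) → δ (A + ee i) i = δ A i
  tri : ∀ A i j, i ≠ j → b A → b (A + ee i) → b (A + ee i + ee j) → ¬ b (A + ee j) →
    δ A i = δ (A + ee i) j
  sq : ∀ A i j, i ≠ j → b A → b (A + ee i) → b (A + ee i + ee j) → b (A + ee j) →
    δ A i * δ (A + ee i) j = δ A j * δ (A + ee j) i
  rect : ∀ A i j k, i ≠ j → i ≠ k → j ≠ k → b A → b (A + ee i) → b (A + ee j + ee k) →
    b (A + ee i + ee j + ee k) → ¬ b (A + ee j) → ¬ b (A + ee k) →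
    ¬ b (A + ee i + ee j) → ¬ b (A + ee i + ee k) → δ A i = δ (A + ee j + ee k) i

structure Pot {n : ℕ} (b : VV n → Prop) (δ : VV n → Fin n → ℤ) (R : VV n → Prop)
    (t : VV n → ℤ) : Prop where
  one : ∀ A, t A * t A = 1
  short : ∀ A i, R A → R (A + ee i) → b A → b (A + ee i) → t A * t (A + ee i) = δ A i
  long : ∀ A i j, i ≠ j → R A → R (A + ee i + ee j) → b A → b (A + ee i + ee j) →
    ¬ (b (A + ee i) ∧ b (A + ee j)) → t A = t (A + ee i + ee j)

lemma Pot.mono {n : ℕ} {b : VV n → Prop} {δ : VV n → Fin n → ℤ} {R R' : VV n → Prop}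
    {t : VV n → ℤ} (h : Pot b δ R t) (hR : ∀ X, R' X → R X) : Pot b δ R' t :=
  ⟨h.one, fun A i h1 h2 => h.short A i (hR _ h1) (hR _ h2),
   fun A i j hij h1 h2 => h.long A i j hij (hR _ h1) (hR _ h2)⟩

lemma ext_two {n : ℕ} {A : VV n} {i z k : Fin n} (hi : k ≠ i) (hz : k ≠ z) :
    (A + ee i + ee z) k = A k := by rw [ee_ne _ hz, ee_ne _ hi]

/-- Any two bases are joined by a path of edges inside the interval they span. -/
lemma path_ind {n : ℕ} {b : VV n → Prop} (hE : Exch b) (Q : VV n → Prop)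
    (B : VV n) (hB : b B) (hQ : Q B) (R : VV n → Prop)
    (hs : ∀ A i, R A → R (A + ee i) → b A → b (A + ee i) → Q (A + ee i) → Q A)
    (hl : ∀ A i j, i ≠ j → R A → R (A + ee i + ee j) → b A → b (A + ee i + ee j) →
      ¬ (b (A + ee i) ∧ b (A + ee j)) → Q (A + ee i + ee j) → Q A) :
    ∀ N A, b A → (Finset.univ.filter fun k => A k ≠ B k).card = N →
      (∀ X, (∀ k, A k = B k → X k = A k) → R X) → Q A := by
  intro N
  induction N using Nat.strong_induction_on with
  | _ N ih =>
  intro A hA hN hR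
  by_cases hAB : A = B
  · rw [hAB]; exact hQ
  obtain ⟨i, hi⟩ := Function.ne_iff.mp hAB
  have key : ∀ C, b C → C i = B i → (∀ k, A k = B k → C k = A k) → Q C := by
    intro C hC hCi hCA
    refine ih _ ?_ C hC rfl ?_
    · rw [← hN]
      apply Finset.card_lt_card
      rw [Finset.ssubset_iff_of_subset]
      · exact ⟨i, by simp [hi], by simp [hCi]⟩
      · intro k
        simp only [Finset.mem_filter, Finset.mem_univ, true_and]
        intro h h'
        exact h ((hCA k h').trans h')
    · intro X hX
      apply hR
      intro k hk
      rw [hX k ((hCA k hk).trans hk), hCA k hk]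
  have hRA : R A := hR A (fun _ _ => rfl)
  by_cases hAi : b (A + ee i)
  · have hC : ∀ k, A k = B k → (A + ee i) k = A k := by
      intro k hk
      exact ee_ne _ (fun h => hi (h ▸ hk))
    exact hs A i hRA (hR _ hC) hA hAi (key _ hAi (by rw [ee_self]; exact z2_one hi) hC)
  · rcases hE A B hA hB i hi with h | ⟨z, hzi, hz, h⟩
    · exact absurd h hAi
    · have hC : ∀ k, A k = B k → (A + ee i + ee z) k = A k := by
        intro k hk
        exact ext_two (fun h => hi (h ▸ hk)) (fun h => hz (h ▸ hk))
      exact hl A i z hzi.symm hRA (hR _ hC) hA h (fun h => hAi h.1)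
        (key _ h (by rw [ee_ne _ hzi.symm, ee_self]; exact z2_one hi) hC)

lemma pot_conn {n : ℕ} {b : VV n → Prop} (hE : Exch b) {δ : VV n → Fin n → ℤ}
    {R : VV n → Prop} {t t' : VV n → ℤ} (h : Pot b δ R t) (h' : Pot b δ R t')
    (A B : VV n) (hA : b A) (hB : b B)
    (hR : ∀ X, (∀ k, A k = B k → X k = A k) → R X) : t A * t B = t' A * t' B := by
  refine path_ind hE (fun A => t A * t B = t' A * t' B) B hB (by rw [h.one, h'.one]) R
    ?_ ?_ _ A hA rfl hR
  · intro A i r1 r2 b1 b2 hq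
    have e1 := h.short A i r1 r2 b1 b2
    have e1' := h'.short A i r1 r2 b1 b2
    calc t A * t B = t A * t (A + ee i) * (t (A + ee i) * t B) := by
          linear_combination (-(t A * t B)) * h.one (A + ee i)
      _ = t' A * t' (A + ee i) * (t' (A + ee i) * t' B) := by rw [e1, e1', hq]
      _ = t' A * t' B := by linear_combination (t' A * t' B) * h'.one (A + ee i)
  · intro A i j hij r1 r2 b1 b2 b3 hq
    rw [h.long A i j hij r1 r2 b1 b2 b3, h'.long A i j hij r1 r2 b1 b2 b3, hq]

def face {n : ℕ} (F : VV n) (D : Finset (Fin n)) (X : VV n) : Prop := ∀ k, k ∉ D → X k = F k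

section top
variable {n : ℕ} {b : VV n → Prop} {δ : VV n → Fin n → ℤ} {T : VV n} {D : Finset (Fin n)}
  {t : VV n → ℤ}

def Rtop {n : ℕ} (T : VV n) (D : Finset (Fin n)) (X : VV n) : Prop := face T D X ∧ X ≠ T

lemma face_add {X : VV n} (h : face T D X) {x : Fin n} (hx : x ∈ D) : face T D (X + ee x) := by
  intro k hk
  rw [ee_ne X (i := x) (k := k) (fun h' => hk (h' ▸ hx))]; exact h k hk

lemma Rtop_of {X : VV n} (h : face T D X) (x : Fin n) (hx : X x ≠ T x) : Rtop T D X :=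
  ⟨h, fun h => hx (by rw [h])⟩

lemma face_self : face T D T := fun _ _ => rfl

lemma Rtop1 {x : Fin n} (hx : x ∈ D) : Rtop T D (T + ee x) :=
  Rtop_of (face_add face_self hx) x (ee_self_ne _ _)

lemma Rtop2 {x y : Fin n} (hx : x ∈ D) (hy : y ∈ D) (h : x ≠ y) :
    Rtop T D (T + ee x + ee y) :=
  Rtop_of (face_add (face_add face_self hx) hy) x (by rw [ee_ne _ h]; exact ee_self_ne _ _)

lemma Rtop3 {x y z : Fin n} (hx : x ∈ D) (hy : y ∈ D) (hz : z ∈ D) (h : x ≠ y) (h' : x ≠ z) :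
    Rtop T D (T + ee x + ee y + ee z) :=
  Rtop_of (face_add (face_add (face_add face_self hx) hy) hz) x
    (by rw [ee_ne _ h', ee_ne _ h]; exact ee_self_ne _ _)

lemma Rtop4 {x y z w : Fin n} (hx : x ∈ D) (hy : y ∈ D) (hz : z ∈ D) (hw : w ∈ D)
    (h : x ≠ y) (h' : x ≠ z) (h'' : x ≠ w) :
    Rtop T D (T + ee x + ee y + ee z + ee w) :=
  Rtop_of (face_add (face_add (face_add (face_add face_self hx) hy) hz) hw) x
    (by rw [ee_ne _ h'', ee_ne _ h', ee_ne _ h]; exact ee_self_ne _ _)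

lemma sgn_solve {a c d : ℤ} (ha : a * a = 1) (h : a * c = d) : c = a * d := by
  rw [← h, ← mul_assoc, ha, one_mul]

lemma top_a (hG : GoodD b δ) (hP : Pot b δ (Rtop T D) t) (hT : b T) {x y : Fin n}
    (hx : x ∈ D) (hy : y ∈ D) (bx : b (T + ee x)) (by' : b (T + ee y)) :
    δ T x * t (T + ee x) = δ T y * t (T + ee y) := by
  by_cases hxy : x = y
  · rw [hxy]
  have c1 : T + ee y + ee x = T + ee x + ee y := by ring
  by_cases h : b (T + ee x + ee y)
  · have h1 := hP.short (T + ee x) y (Rtop1 hx) (Rtop2 hx hy hxy) bx h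
    have h2 := hP.short (T + ee y) x (Rtop1 hy) (Rtop2 hy hx (Ne.symm hxy)) by' (c1 ▸ h)
    have h3 := hG.sq T x y hxy hT bx h by'
    rw [c1] at h2
    rw [← h1, ← h2] at h3
    have h4 := hP.one (T + ee x + ee y)
    linear_combination (t (T + ee x + ee y)) * h3 - (δ T x * t (T + ee x) - δ T y * t (T + ee y)) * h4
  · have e1 : T + ee x + ee x = T := ee_cancel _ _
    have h3 := hG.tri (T + ee x) x y hxy bx (by rwa [e1]) (by rwa [e1]) h
    rw [hG.symm T x hT bx, e1] at h3
    have e2' : T + ee x + ee x + ee y = T + ee y := by rw [e1]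
    have h4 := hP.long (T + ee x) x y hxy (Rtop1 hx) (by rw [e1]; exact Rtop1 hy) bx
      (by rwa [e1]) (fun h' => h h'.2)
    rw [e1] at h4
    rw [h3, h4]

lemma top_tri (hG : GoodD b δ) (hP : Pot b δ (Rtop T D) t) (hT : b T) {x y : Fin n}
    (hx : x ∈ D) (hy : y ∈ D) (hxy : x ≠ y) (bx : b (T + ee x)) (bxy : b (T + ee x + ee y))
    (nby : ¬ b (T + ee y)) :
    δ T x * t (T + ee x) = t (T + ee x + ee y) := by
  have h1 := hG.tri T x y hxy hT bx bxy nby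
  have h2 := hP.short (T + ee x) y (Rtop1 hx) (Rtop2 hx hy hxy) bx bxy
  rw [h1, ← h2]
  linear_combination (t (T + ee x + ee y)) * hP.one (T + ee x)

lemma pure_overlap (hP : Pot b δ (Rtop T D) t) {x y z : Fin n}
    (hx : x ∈ D) (hy : y ∈ D) (hz : z ∈ D) (hxy : x ≠ y) (hxz : x ≠ z) (hyz : y ≠ z)
    (b1 : b (T + ee x + ee y)) (b2 : b (T + ee x + ee z)) (nbx : ¬ b (T + ee x)) :
    t (T + ee x + ee y) = t (T + ee x + ee z) := by
  have e1 : T + ee x + ee y + ee y = T + ee x := ee_cancel _ _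
  have h := hP.long (T + ee x + ee y) y z hyz (Rtop2 hx hy hxy)
    (by rw [e1]; exact Rtop2 hx hz hxz) b1 (by rwa [e1]) (fun h => nbx (e1 ▸ h.1))
  rwa [e1] at h

lemma top_b (hE : Exch b) (hG : GoodD b δ) (hP : Pot b δ (Rtop T D) t) (hT : b T)
    {x y z : Fin n} (hx : x ∈ D) (hy : y ∈ D) (hz : z ∈ D) (hyz : y ≠ z) (bx : b (T + ee x))
    (byz : b (T + ee y + ee z)) (nby : ¬ b (T + ee y)) (nbz : ¬ b (T + ee z)) :
    δ T x * t (T + ee x) = t (T + ee y + ee z) := by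
  have hxy : x ≠ y := fun h => nby (h ▸ bx)
  have hxz : x ≠ z := fun h => nbz (h ▸ bx)
  have cyx : T + ee y + ee x = T + ee x + ee y := by ring
  have czx : T + ee z + ee x = T + ee x + ee z := by ring
  have czy : T + ee z + ee y = T + ee y + ee z := by ring
  by_cases h1 : b (T + ee x + ee y)
  · rw [top_tri hG hP hT hx hy hxy bx h1 nby, ← cyx]
    exact pure_overlap hP hy hx hz hxy.symm hyz hxz (cyx ▸ h1) byz nby
  by_cases h2 : b (T + ee x + ee z)
  · rw [top_tri hG hP hT hx hz hxz bx h2 nbz, ← czx, ← czy]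
    exact pure_overlap hP hz hx hy hxz.symm hyz.symm hxy (czx ▸ h2) (czy ▸ byz) nbz
  have h3 : b (T + ee x + ee y + ee z) := by
    rcases hE (T + ee x) (T + ee y + ee z) bx byz y
      (by rw [ee_ne _ hyz, ee_self, ee_ne _ hxy.symm]; exact (z2_ne _).symm) with h | ⟨w, hw, hw', h⟩
    · exact absurd h h1
    · by_cases hwx : w = x
      · subst hwx
        have : T + ee w + ee y + ee w = T + ee y := by linear_combination e2 w
        exact absurd (this ▸ h) nby
      by_cases hwz : w = z
      · exact hwz ▸ h
      exact absurd (by rw [ee_ne _ hwx, ext_two hw hwz]) hw'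
  have c4 : T + ee y + ee z + ee x = T + ee x + ee y + ee z := by ring
  have h4 := hG.rect T x y z hxy hxz hyz hT bx byz h3 nby nbz h1 h2
  have h5 := hP.long (T + ee x) y z hyz (Rtop1 hx) (Rtop3 hx hy hz hxy hxz) bx h3 (fun h => h1 h.1)
  have h6 := hP.short (T + ee y + ee z) x (Rtop2 hy hz hyz) (by rw [c4]; exact Rtop3 hx hy hz hxy hxz)
    byz (by rwa [c4])
  rw [c4] at h6
  rw [h4, ← h6, h5]
  linear_combination (t (T + ee y + ee z)) * hP.one (T + ee x + ee y + ee z)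

/-- helper for `top_c`: three-fold exchange back to `T`. -/
lemma top_no3 (hE : Exch b) (hT : b T) {x y z : Fin n} (hxy : x ≠ y) (hxz : x ≠ z) (hyz : y ≠ z)
    (n1 : ¬ b (T + ee x)) (n2 : ¬ b (T + ee y)) (n3 : ¬ b (T + ee x + ee y)) :
    ¬ b (T + ee x + ee y + ee z) := by
  intro h
  rcases hE _ T h hT z (by rw [ee_self, ext_two hxz.symm hyz.symm]; exact z2_ne _) with h' | ⟨w, hw, hw', h'⟩
  · rw [ee_cancel] at h'; exact n3 h'
  · by_cases hwx : w = x
    · subst hwx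
      have : T + ee w + ee y + ee z + ee z + ee w = T + ee y := by linear_combination e2 w + e2 z
      exact n2 (this ▸ h')
    by_cases hwy : w = y
    · subst hwy
      have : T + ee x + ee w + ee z + ee z + ee w = T + ee x := by linear_combination e2 w + e2 z
      exact n1 (this ▸ h')
    exact hw' (by rw [ee_ne _ hw, ext_two hwx hwy])

lemma top_c (hE : Exch b) (hP : Pot b δ (Rtop T D) t) (hT : b T)
    {x y z w : Fin n} (hx : x ∈ D) (hy : y ∈ D) (hz : z ∈ D) (hw : w ∈ D)
    (hn : ∀ x ∈ D, ¬ b (T + ee x))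
    (hxy : x ≠ y) (hzw : z ≠ w) (bxy : b (T + ee x + ee y)) (bzw : b (T + ee z + ee w)) :
    t (T + ee x + ee y) = t (T + ee z + ee w) := by
  have cm : ∀ x y : Fin n, T + ee x + ee y = T + ee y + ee x := by intro x y; ring
  have ov : ∀ x y z : Fin n, x ∈ D → y ∈ D → z ∈ D → x ≠ y → x ≠ z → b (T + ee x + ee y) →
      b (T + ee x + ee z) → t (T + ee x + ee y) = t (T + ee x + ee z) := by
    intro x y z hx hy hz hxy hxz b1 b2
    by_cases hyz : y = z
    · rw [hyz]
    exact pure_overlap hP hx hy hz hxy hxz hyz b1 b2 (hn x hx)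
  by_cases h1 : x = z
  · subst h1; exact ov x y w hx hy hw hxy hzw bxy bzw
  by_cases h2 : x = w
  · subst h2; rw [cm z x]; exact ov x y z hx hy hz hxy hzw.symm bxy (cm z x ▸ bzw)
  by_cases h3 : y = z
  · subst h3; rw [cm x y]; exact ov y x w hy hx hw hxy.symm hzw (cm x y ▸ bxy) bzw
  by_cases h4 : y = w
  · subst h4
    rw [cm x y, cm z y]
    exact ov y x z hy hx hz hxy.symm hzw.symm (cm x y ▸ bxy) (cm z y ▸ bzw)
  -- connecting through a mixed pair
  have mix : ∀ x y z w : Fin n, x ∈ D → y ∈ D → z ∈ D → w ∈ D → x ≠ y → z ≠ w → x ≠ z →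
      b (T + ee x + ee y) → b (T + ee z + ee w) → b (T + ee x + ee z) →
      t (T + ee x + ee y) = t (T + ee z + ee w) := by
    intro x y z w hx hy hz hw hxy hzw hxz b1 b2 b3
    rw [ov x y z hx hy hz hxy hxz b1 b3, cm x z]
    exact ov z x w hz hx hw hxz.symm hzw (cm x z ▸ b3) b2
  by_cases m1 : b (T + ee x + ee z)
  · exact mix x y z w hx hy hz hw hxy hzw h1 bxy bzw m1
  by_cases m2 : b (T + ee x + ee w)
  · rw [cm z w]; exact mix x y w z hx hy hw hz hxy hzw.symm h2 bxy (cm z w ▸ bzw) m2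
  by_cases m3 : b (T + ee y + ee z)
  · rw [cm x y]; exact mix y x z w hy hx hz hw hxy.symm hzw h3 (cm x y ▸ bxy) bzw m3
  by_cases m4 : b (T + ee y + ee w)
  · rw [cm x y, cm z w]
    exact mix y x w z hy hx hw hz hxy.symm hzw.symm h4 (cm x y ▸ bxy) (cm z w ▸ bzw) m4
  have n3 : ¬ b (T + ee x + ee y + ee z) := by
    have := top_no3 hE hT h1 hxy (Ne.symm h3) (hn x hx) (hn z hz) m1
    rwa [show T + ee x + ee z + ee y = T + ee x + ee y + ee z by ring] at this
  have n3' : ¬ b (T + ee z + ee w + ee x) := by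
    have := top_no3 hE hT (x := x) (y := z) (z := w) h1 h2 hzw (hn x hx) (hn z hz) m1
    rwa [show T + ee x + ee z + ee w = T + ee z + ee w + ee x by ring] at this
  have b4 : b (T + ee x + ee y + ee z + ee w) := by
    rcases hE _ _ bxy bzw z
      (by rw [ext_two (Ne.symm h1) (Ne.symm h3), ee_ne _ hzw, ee_self]; exact (z2_ne _).symm) with
      h | ⟨v, hv, hv', h⟩
    · exact absurd h n3
    · by_cases hvx : v = x
      · subst hvx
        have : T + ee v + ee y + ee z + ee v = T + ee y + ee z := by linear_combination e2 v
        exact absurd (this ▸ h) m3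
      by_cases hvy : v = y
      · subst hvy
        have : T + ee x + ee v + ee z + ee v = T + ee x + ee z := by linear_combination e2 v
        exact absurd (this ▸ h) m1
      by_cases hvw : v = w
      · exact hvw ▸ h
      exact absurd (by rw [ext_two hvx hvy, ext_two hv hvw]) hv'
  have r4 : Rtop T D (T + ee x + ee y + ee z + ee w) := Rtop4 hx hy hz hw hxy h1 h2
  have c4 : T + ee z + ee w + ee x + ee y = T + ee x + ee y + ee z + ee w := by ring
  rw [hP.long (T + ee x + ee y) z w hzw (Rtop2 hx hy hxy) r4 bxy b4 (fun h => n3 h.1),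
    hP.long (T + ee z + ee w) x y hxy (Rtop2 hz hw hzw) (by rwa [c4]) bzw (by rwa [c4])
      (fun h => n3' h.1), c4]

lemma top_all (hE : Exch b) (hG : GoodD b δ) (hP : Pot b δ (Rtop T D) t) (hT : b T) :
    ∃ τ : ℤ, τ * τ = 1 ∧ (∀ x ∈ D, b (T + ee x) → τ * t (T + ee x) = δ T x) ∧
      ∀ x ∈ D, ∀ y ∈ D, x ≠ y → b (T + ee x + ee y) → ¬ (b (T + ee x) ∧ b (T + ee y)) →
        τ = t (T + ee x + ee y) := by
  have cm : ∀ x y : Fin n, T + ee x + ee y = T + ee y + ee x := by intro x y; ring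
  by_cases h : ∃ a ∈ D, b (T + ee a)
  · obtain ⟨a, ha, hba⟩ := h
    refine ⟨δ T a * t (T + ee a), ?_, ?_, ?_⟩
    · linear_combination (t (T + ee a) * t (T + ee a)) * hG.one T a hT hba + hP.one (T + ee a)
    · intro x hx bx
      rw [top_a hG hP hT ha hx hba bx]
      linear_combination δ T x * hP.one (T + ee x)
    · intro x hx y hy hxy bxy hnb
      by_cases bx : b (T + ee x)
      · rw [top_a hG hP hT ha hx hba bx]
        exact top_tri hG hP hT hx hy hxy bx bxy (fun h => hnb ⟨bx, h⟩)
      by_cases by' : b (T + ee y)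
      · rw [top_a hG hP hT ha hy hba by', cm x y]
        exact top_tri hG hP hT hy hx hxy.symm by' (cm x y ▸ bxy) bx
      exact top_b hE hG hP hT ha hx hy hxy hba bxy bx by'
  · push Not at h
    by_cases h2 : ∃ x ∈ D, ∃ y ∈ D, x ≠ y ∧ b (T + ee x + ee y)
    · obtain ⟨x, hx, y, hy, hxy, bxy⟩ := h2
      refine ⟨t (T + ee x + ee y), hP.one _, fun x hx hb => absurd hb (h x hx), ?_⟩
      intro z hz w hw hzw bzw _
      exact top_c hE hP hT hx hy hz hw h hxy hzw bxy bzw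
    · push Not at h2
      exact ⟨1, by norm_num, fun x hx hb => absurd hb (h x hx),
        fun x hx y hy hxy hb => absurd hb (h2 x hx y hy hxy)⟩
end top

lemma face_mono {n : ℕ} {F X : VV n} {D D' : Finset (Fin n)} (h : D ⊆ D') (hX : face F D X) :
    face F D' X := fun k hk => hX k (fun h' => hk (h h'))

lemma face_interval {n : ℕ} {F A B : VV n} {D : Finset (Fin n)} (hA : face F D A)
    (hB : face F D B) {X : VV n} (hX : ∀ k, A k = B k → X k = A k) : face F D X := by
  intro k hk
  rw [hX k ((hA k hk).trans (hB k hk).symm), hA k hk]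

lemma face_erase {n : ℕ} {F X : VV n} {D : Finset (Fin n)} {x : Fin n} (h : face F D X)
    (hx : X x = F x) : face F (D.erase x) X := by
  intro k hk
  by_cases hkx : k = x
  · rw [hkx, hx]
  · exact h k (fun hkD => hk (Finset.mem_erase.mpr ⟨hkx, hkD⟩))

/-- opposite vertex of `F` in the face `D`. -/
def opp {n : ℕ} (F : VV n) (D : Finset (Fin n)) : VV n := fun k => if k ∈ D then F k + 1 else F k

lemma opp_face {n : ℕ} (F : VV n) (D : Finset (Fin n)) : face F D (opp F D) := by
  intro k hk; simp [opp, hk]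

lemma opp_ne {n : ℕ} (F : VV n) {D : Finset (Fin n)} {x : Fin n} (hx : x ∈ D) :
    opp F D x ≠ F x := by
  simp [opp, hx]

lemma eq_opp {n : ℕ} {F X : VV n} {D : Finset (Fin n)} (h : face F D X)
    (hX : ∀ x ∈ D, X x ≠ F x) : X = opp F D := by
  ext k
  by_cases hk : k ∈ D
  · simp only [opp, hk, if_true]; exact (z2_one (hX k hk).symm).symm
  · rw [h k hk]; simp [opp, hk]

lemma face_opp_iff {n : ℕ} {F X : VV n} {D : Finset (Fin n)} :
    face (opp F D) D X ↔ face F D X := by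
  constructor
  · intro h k hk; rw [h k hk, opp_face F D k hk]
  · intro h k hk; rw [h k hk, opp_face F D k hk]

lemma mem_of_face {n : ℕ} {F X : VV n} {D : Finset (Fin n)} {i : Fin n} (h : face F D X)
    (h' : face F D (X + ee i)) : i ∈ D := by
  by_contra hi
  exact ee_self_ne X i ((h' i hi).trans (h i hi).symm)

lemma mem_of_face2 {n : ℕ} {F X : VV n} {D : Finset (Fin n)} {i j : Fin n} (hij : i ≠ j)
    (h : face F D X) (h' : face F D (X + ee i + ee j)) : i ∈ D ∧ j ∈ D := by
  constructor
  · by_contra hi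
    have := (h' i hi).trans (h i hi).symm
    rw [ee_ne _ hij] at this
    exact ee_self_ne X i this
  · by_contra hi
    have := (h' j hi).trans (h j hi).symm
    rw [ee_self, ee_ne _ hij.symm] at this
    exact z2_ne _ this

theorem homotopy {n : ℕ} {b : VV n → Prop} {δ : VV n → Fin n → ℤ} (hE : Exch b)
    (hG : GoodD b δ) : ∀ (N : ℕ) (D : Finset (Fin n)) (F : VV n), D.card = N → b F →
      ∃ t, Pot b δ (face F D) t := by
  intro N
  induction N using Nat.strong_induction_on with
  | _ N ih =>
  intro D F hD hF
  -- potentials on the facets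
  have hfac : ∀ x, ∃ t : VV n → ℤ, x ∈ D → Pot b δ (face F (D.erase x)) t ∧ t F = 1 := by
    intro x
    by_cases hx : x ∈ D
    · obtain ⟨t, ht⟩ := ih _ (by rw [← hD]; exact Finset.card_erase_lt_of_mem hx) (D.erase x) F rfl hF
      refine ⟨fun A => t F * t A, fun _ => ⟨⟨?_, ?_, ?_⟩, ht.one F⟩⟩
      · intro A; linear_combination (t F * t F) * ht.one A + ht.one F
      · intro A i r1 r2 b1 b2
        rw [← ht.short A i r1 r2 b1 b2]
        linear_combination (t A * t (A + ee i)) * ht.one F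
      · intro A i j hij r1 r2 b1 b2 b3
        simp only [ht.long A i j hij r1 r2 b1 b2 b3]
    · exact ⟨fun _ => 1, fun h => absurd h hx⟩
  choose tx htx using hfac
  -- glue
  set t0 : VV n → ℤ := fun A => if h : ∃ x ∈ D, A x = F x then tx h.choose A else 1 with ht0
  have one0 : ∀ A, t0 A * t0 A = 1 := by
    intro A
    by_cases h : ∃ x ∈ D, A x = F x
    · simp only [ht0, dif_pos h]
      exact (htx _ h.choose_spec.1).1.one A
    · simp only [ht0, dif_neg h]; norm_num
  have t0eq : ∀ A x, b A → face F D A → x ∈ D → A x = F x → t0 A = tx x A := by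
    intro A x hA hfA hx hAx
    have h : ∃ x ∈ D, A x = F x := ⟨x, hx, hAx⟩
    simp only [ht0, dif_pos h]
    have h1 := htx _ h.choose_spec.1
    have h2 := htx _ hx
    have hy := h.choose_spec
    have := pot_conn hE (R := fun X => face F (D.erase x) X ∧ face F (D.erase h.choose) X)
      (h1.1.mono fun X hX => hX.2) (h2.1.mono fun X hX => hX.1) F A hF hA
      (fun X hX => ⟨face_interval (fun _ _ => rfl) (face_erase hfA hAx) hX,
        face_interval (fun _ _ => rfl) (face_erase hfA hy.2) hX⟩)
    rw [h1.2, h2.2, one_mul, one_mul] at this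
    exact this
  have short0 : ∀ x ∈ D, ∀ A i, face F D A → face F D (A + ee i) → b A → b (A + ee i) →
      A x = F x → (A + ee i) x = F x → t0 A * t0 (A + ee i) = δ A i := by
    intro x hx A i r1 r2 b1 b2 h1 h2
    rw [t0eq A x b1 r1 hx h1, t0eq _ x b2 r2 hx h2]
    exact (htx x hx).1.short A i (face_erase r1 h1) (face_erase r2 h2) b1 b2
  have long0 : ∀ x ∈ D, ∀ A i j, i ≠ j → face F D A → face F D (A + ee i + ee j) → b A →
      b (A + ee i + ee j) → ¬ (b (A + ee i) ∧ b (A + ee j)) →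
      A x = F x → (A + ee i + ee j) x = F x → t0 A = t0 (A + ee i + ee j) := by
    intro x hx A i j hij r1 r2 b1 b2 b3 h1 h2
    rw [t0eq A x b1 r1 hx h1, t0eq _ x b2 r2 hx h2]
    exact (htx x hx).1.long A i j hij (face_erase r1 h1) (face_erase r2 h2) b1 b2 b3
  set T := opp F D with hTdef
  have hfT : face F D T := opp_face F D
  have fadd : ∀ X x, face F D X → x ∈ D → face F D (X + ee x) := by
    intro X x hX hx k hk
    rw [ee_ne X (i := x) (k := k) (fun h' => hk (h' ▸ hx))]; exact hX k hk
  have Tx : ∀ x ∈ D, T x + 1 = F x := fun x hx => z2_one (opp_ne F hx)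
  -- bad long edges
  have bad : ∀ i j, i ∈ D → j ∈ D → i ≠ j → b (T + ee i) → b (T + ee j) →
      ¬ (b T ∧ b (T + ee i + ee j)) → t0 (T + ee i) = t0 (T + ee j) := by
    intro i j hi hj hij bi bj hnb
    have fi := fadd T i hfT hi
    have fj := fadd T j hfT hj
    have cij : T + ee j + ee i = T + ee i + ee j := by ring
    have vi : (T + ee i) i = F i := by rw [ee_self]; exact Tx i hi
    have vj : (T + ee j) j = F j := by rw [ee_self]; exact Tx j hj
    have vij : (T + ee i + ee j) i = F i := by rw [ee_ne _ hij]; exact vi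
    have vji : (T + ee i + ee j) j = F j := by rw [← cij, ee_ne _ hij.symm]; exact vj
    by_cases hb : b (T + ee i + ee j)
    · have hbT : ¬ b T := fun h => hnb ⟨h, hb⟩
      have e1 : T + ee i + ee j + ee i = T + ee j := by linear_combination e2 i
      have h1 := hG.tri (T + ee i) j i hij.symm bi hb (by rwa [e1]) (by rwa [ee_cancel])
      have h2 := short0 i hi (T + ee i) j fi (fadd _ _ fi hj) bi hb vi vij
      have h3 := short0 j hj (T + ee i + ee j) i (fadd _ _ fi hj) (by rwa [e1]) hb (by rwa [e1])
        vji (by rwa [e1])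
      rw [e1] at h3
      rw [← h2, ← h3] at h1
      linear_combination (t0 (T + ee i + ee j)) * h1 -
        (t0 (T + ee i) - t0 (T + ee j)) * one0 (T + ee i + ee j)
    · rcases hE _ F bi hF j (by rw [ee_ne _ hij.symm]; exact opp_ne F hj) with h | ⟨z, hzj, hz, h⟩
      · exact absurd h hb
      have hzi : z ≠ i := by rintro rfl; exact hz vi
      have hzD : z ∈ D := by
        by_contra hzD
        exact hz (fi z hzD)
      have fC : face F D (T + ee i + ee j + ee z) := fadd _ _ (fadd _ _ fi hj) hzD
      have vC : (T + ee i + ee j + ee z) i = F i := by rw [ee_ne _ hzi.symm]; exact vij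
      have vC' : (T + ee i + ee j + ee z) j = F j := by rw [ee_ne _ hzj.symm]; exact vji
      by_cases hk : ∃ k ∈ D, k ≠ i ∧ k ≠ j ∧ k ≠ z
      · obtain ⟨k, hkD, hki, hkj, hkz⟩ := hk
        obtain ⟨t', ht'⟩ := ih _ (by rw [← hD]; exact Finset.card_erase_lt_of_mem hkD)
          (D.erase k) (T + ee i) rfl bi
        have gi : face (T + ee i) (D.erase k) (T + ee i) := fun _ _ => rfl
        have gD : ∀ X, face F D X → X k = T k → face (T + ee i) (D.erase k) X := by
          intro X hX hXk
          apply face_erase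
          · intro l hl; rw [hX l hl, fi l hl]
          · rw [hXk, ee_ne _ hki]
        have gj : face (T + ee i) (D.erase k) (T + ee j) := gD _ fj (ee_ne _ hkj)
        have gC : face (T + ee i) (D.erase k) (T + ee i + ee j + ee z) :=
          gD _ fC (by rw [ee_ne _ hkz, ext_two hki hkj])
        have key : ∀ A x, x ∈ D → b A → face F D A → A x = F x →
            (T + ee i + ee j + ee z) x = F x → face (T + ee i) (D.erase k) A →
            t0 A * t0 (T + ee i + ee j + ee z) = t' A * t' (T + ee i + ee j + ee z) := by
          intro A x hx hA hfA hAx hCx gA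
          rw [t0eq A x hA hfA hx hAx, t0eq _ x h fC hx hCx]
          refine pot_conn hE
            (R := fun X => face F (D.erase x) X ∧ face (T + ee i) (D.erase k) X)
            ((htx x hx).1.mono fun X hX => hX.1) (ht'.mono fun X hX => hX.2) _ _ hA h ?_
          intro X hX
          exact ⟨face_interval (face_erase hfA hAx) (face_erase fC hCx) hX,
            face_interval gA gC hX⟩
        have k1 := key (T + ee i) i hi bi fi vi vC gi
        have k2 := key (T + ee j) j hj bj fj vj vC' gj
        have e1 : T + ee i + ee i = T := ee_cancel _ _
        have k3 := ht'.long (T + ee i) i j hij gi (by rwa [e1]) bi (by rwa [e1])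
          (by rw [e1]; exact hnb)
        rw [e1] at k3
        rw [k3, ← k2] at k1
        linear_combination (t0 (T + ee i + ee j + ee z)) * k1 -
          (t0 (T + ee i) - t0 (T + ee j)) * one0 (T + ee i + ee j + ee z)
      · have c2 : T + ee j + ee i + ee z = T + ee i + ee j + ee z := by ring
        rw [long0 i hi (T + ee i) j z hzj.symm fi fC bi h (fun h => hb h.1) vi vC,
          long0 j hj (T + ee j) i z hzi.symm fj (by rwa [c2]) bj (by rwa [c2])
            (fun h => hb (cij ▸ h.1)) vj (by rwa [c2]), c2]
  have pot0 : Pot b δ (Rtop T D) t0 := by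
    refine ⟨one0, ?_, ?_⟩
    · intro A i r1 r2 b1 b2
      have f1 := face_opp_iff.mp r1.1
      have f2 := face_opp_iff.mp r2.1
      have hi := mem_of_face f1 f2
      by_cases hx : ∃ x ∈ D, x ≠ i ∧ A x = F x
      · obtain ⟨x, hx, hxi, hAx⟩ := hx
        exact short0 x hx A i f1 f2 b1 b2 hAx (by rw [ee_ne _ hxi]; exact hAx)
      · push Not at hx
        exfalso
        by_cases hAi : A i = F i
        · refine r2.2 (eq_opp f2 fun x hxD => ?_)
          by_cases hxi : x = i
          · rw [hxi, ee_self, ← hAi]; exact z2_ne _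
          · rw [ee_ne _ hxi]; exact hx x hxD hxi
        · refine r1.2 (eq_opp f1 fun x hxD => ?_)
          by_cases hxi : x = i
          · rw [hxi]; exact hAi
          · exact hx x hxD hxi
    · intro A i j hij r1 r2 b1 b2 b3
      have f1 := face_opp_iff.mp r1.1
      have f2 := face_opp_iff.mp r2.1
      obtain ⟨hi, hj⟩ := mem_of_face2 hij f1 f2
      by_cases hx : ∃ x ∈ D, x ≠ i ∧ x ≠ j ∧ A x = F x
      · obtain ⟨x, hx, hxi, hxj, hAx⟩ := hx
        exact long0 x hx A i j hij f1 f2 b1 b2 b3 hAx (by rw [ext_two hxi hxj]; exact hAx)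
      · push Not at hx
        have fin : ∀ i j, i ∈ D → j ∈ D → i ≠ j → (∀ x ∈ D, x ≠ i → x ≠ j → A x ≠ F x) →
            A i = F i → A j ≠ F j → A = T + ee i := by
          intro i j hi hj hij hx h1 h2
          have : A + ee i = T := by
            refine eq_opp (fadd _ _ f1 hi) fun x hxD => ?_
            by_cases hxi : x = i
            · rw [hxi, ee_self, ← h1]; exact z2_ne _
            · rw [ee_ne _ hxi]
              by_cases hxj : x = j
              · rw [hxj]; exact h2
              · exact hx x hxD hxi hxj
          rw [← this, ee_cancel]
        by_cases hAi : A i = F i <;> by_cases hAj : A j = F j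
        · exfalso
          refine r2.2 (eq_opp f2 fun x hxD => ?_)
          by_cases hxj : x = j
          · rw [hxj, ee_self, ee_ne _ hij.symm, ← hAj]; exact z2_ne _
          · rw [ee_ne _ hxj]
            by_cases hxi : x = i
            · rw [hxi, ee_self, ← hAi]; exact z2_ne _
            · rw [ee_ne _ hxi]; exact hx x hxD hxi hxj
        · have hA := fin i j hi hj hij hx hAi hAj
          have e1 : A + ee i = T := by rw [hA, ee_cancel]
          rw [e1] at b2 b3 ⊢
          rw [hA] at b1 b3 ⊢
          exact bad i j hi hj hij b1 b2 b3
        · have hA := fin j i hj hi hij.symm (fun x a c d => hx x a d c) hAj hAi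
          have e1 : A + ee j = T := by rw [hA, ee_cancel]
          have e3 : A + ee i + ee j = T + ee i := by rw [← e1]; ring
          rw [e3] at b2 ⊢
          rw [e1] at b3
          rw [hA] at b1 b3 ⊢
          exact bad j i hj hi hij.symm b1 b2 (fun h => b3 ⟨h.2, h.1⟩)
        · exfalso
          refine r1.2 (eq_opp f1 fun x hxD => ?_)
          by_cases hxi : x = i
          · rw [hxi]; exact hAi
          by_cases hxj : x = j
          · rw [hxj]; exact hAj
          exact hx x hxD hxi hxj
  by_cases hbT : b T
  · obtain ⟨τ, hτ, hτ1, hτ2⟩ := top_all hE hG pot0 hbT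
    refine ⟨fun A => if A = T then τ else t0 A, ?_, ?_, ?_⟩
    · intro A; split_ifs
      · exact hτ
      · exact one0 A
    · intro A i f1 f2 b1 b2
      have hi := mem_of_face f1 f2
      by_cases h1 : A = T
      · have h2 : A + ee i ≠ T := fun h => ee_self_ne A i (by rw [h, h1])
        rw [if_pos h1, if_neg h2]
        subst h1
        exact hτ1 i hi b2
      · by_cases h2 : A + ee i = T
        · have hA : A = T + ee i := by rw [← h2, ee_cancel]
          rw [if_neg h1, if_pos h2, mul_comm, hA, hτ1 i hi (hA ▸ b1)]
          exact (hG.symm T i hbT (hA ▸ b1)).symm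
        · rw [if_neg h1, if_neg h2]
          exact pot0.short A i ⟨face_opp_iff.mpr f1, h1⟩ ⟨face_opp_iff.mpr f2, h2⟩ b1 b2
    · intro A i j hij f1 f2 b1 b2 b3
      obtain ⟨hi, hj⟩ := mem_of_face2 hij f1 f2
      by_cases h1 : A = T
      · have h2 : A + ee i + ee j ≠ T := fun h => ee_self_ne A i (by
          rw [← ee_ne (A + ee i) hij, h, h1])
        simp only [if_pos h1, if_neg h2]
        subst h1
        exact hτ2 i hi j hj hij b2 b3
      · by_cases h2 : A + ee i + ee j = T
        · have hA : A = T + ee i + ee j := by rw [← h2]; linear_combination -e2 i - e2 j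
          have hAi : A + ee i = T + ee j := by rw [← h2]; linear_combination -e2 j
          have hAj : A + ee j = T + ee i := by rw [← h2]; linear_combination -e2 i
          simp only [if_neg h1, if_pos h2]
          rw [hAi, hAj] at b3
          rw [hA]
          exact (hτ2 i hi j hj hij (hA ▸ b1) (fun h => b3 ⟨h.2, h.1⟩)).symm
        · simp only [if_neg h1, if_neg h2]
          exact pot0.long A i j hij ⟨face_opp_iff.mpr f1, h1⟩ ⟨face_opp_iff.mpr f2, h2⟩ b1 b2 b3
  · refine ⟨t0, one0, ?_, ?_⟩
    · intro A i f1 f2 b1 b2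
      exact pot0.short A i ⟨face_opp_iff.mpr f1, fun h => hbT (h ▸ b1)⟩
        ⟨face_opp_iff.mpr f2, fun h => hbT (h ▸ b2)⟩ b1 b2
    · intro A i j hij f1 f2 b1 b2 b3
      exact pot0.long A i j hij ⟨face_opp_iff.mpr f1, fun h => hbT (h ▸ b1)⟩
        ⟨face_opp_iff.mpr f2, fun h => hbT (h ▸ b2)⟩ b1 b2 b3

lemma z2_cases (a : ZMod 2) : a = 0 ∨ a = 1 := by revert a; decide

def toS {n : ℕ} (x : VV n) : Finset (JJ n) :=
  Finset.univ.filter fun p => p.2 = decide (x p.1 = 1)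

lemma mem_toS {n : ℕ} (x : VV n) (p : JJ n) : p ∈ toS x ↔ p.2 = decide (x p.1 = 1) := by
  simp [toS]

lemma dec_iff {a c : ZMod 2} : decide (a = 1) = decide (c = 1) ↔ a = c := by
  revert a c; decide

lemma dec_ne {a c : ZMod 2} (h : a ≠ c) : decide (a = 1) = !decide (c = 1) := by
  revert a c; decide

lemma toS_inj {n : ℕ} {x y : VV n} (h : toS x = toS y) : x = y := by
  ext i
  have h1 : (i, decide (x i = 1)) ∈ toS x := by simp [mem_toS]
  rw [h, mem_toS] at h1
  exact dec_iff.mp h1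

lemma toS_inj_iff {n : ℕ} {x y : VV n} : toS x = toS y ↔ x = y :=
  ⟨toS_inj, fun h => h ▸ rfl⟩

def chi {n : ℕ} (A : Finset (JJ n)) : VV n := fun i => if (i, true) ∈ A then 1 else 0

lemma toS_chi {n : ℕ} {A : Finset (JJ n)} (h1 : AdmissibleSet A) (h2 : A.card = n) :
    toS (chi A) = A := by
  have hinj : Set.InjOn Prod.fst (A : Set (JJ n)) := by
    rintro ⟨i, c⟩ hp ⟨j, d⟩ hq hpq
    simp only at hpq
    subst hpq
    by_cases hcd : c = d
    · rw [hcd]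
    · exfalso
      have := h1 _ hp
      have e : starJ (i, c) = (i, d) := by
        simp only [starJ]; cases c <;> cases d <;> simp_all
      rw [e] at this
      exact this hq
  have him : A.image Prod.fst = Finset.univ := by
    apply Finset.eq_univ_of_card
    rw [Finset.card_image_of_injOn hinj, h2, Fintype.card_fin]
  ext ⟨i, c⟩
  rw [mem_toS]
  have hi : i ∈ A.image Prod.fst := by rw [him]; exact Finset.mem_univ _
  obtain ⟨⟨j, d⟩, hq, hj⟩ := Finset.mem_image.mp hi
  simp only at hj
  subst hj
  simp only [chi]
  have hs := h1 _ hq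
  cases d <;> cases c <;> simp_all [starJ]

/-- real sign -/
noncomputable def sg (a : ZMod 2) : ℝ := if a = 1 then -1 else 1

lemma sg_flip (a : ZMod 2) : sg (a + 1) = - sg a := by
  rcases z2_cases a with rfl | rfl
  · simp [sg]
  · simp [sg, show (1 : ZMod 2) + 1 = 0 from by decide]

lemma sg_sq (a : ZMod 2) : sg a * sg a = 1 := by
  unfold sg; split_ifs <;> norm_num

lemma sg_inj {a c : ZMod 2} (h : sg a = sg c) : a = c := by
  rcases z2_cases a with rfl | rfl <;> rcases z2_cases c with rfl | rfl <;> simp [sg] at h ⊢ <;>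
    linarith

lemma sg_ne {a c : ZMod 2} (h : a ≠ c) : sg c = - sg a := by
  rw [← z2_one h, sg_flip]

lemma eSet_toS {n : ℕ} (x : VV n) (i : Fin n) : eSet (toS x) i = sg (x i) := by
  unfold eSet
  rw [Finset.sum_apply]
  rw [Finset.sum_eq_single (i, decide (x i = 1))]
  · simp [eVec, sg]
  · rintro ⟨j, c⟩ hp hne
    rw [mem_toS] at hp
    simp only [eVec]
    rw [if_neg]
    rintro rfl
    exact hne (by rw [Prod.ext_iff]; exact ⟨rfl, hp⟩)
  · intro h; exact absurd (by simp [mem_toS]) h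

lemma eSet_toS_fun {n : ℕ} (x : VV n) : eSet (toS x) = fun i => sg (x i) := by
  ext i; exact eSet_toS x i

lemma mem_symmDiff_toS {n : ℕ} (x y : VV n) (p : JJ n) :
    p ∈ symmDiff (toS x) (toS y) ↔ x p.1 ≠ y p.1 := by
  rw [Finset.mem_symmDiff, mem_toS, mem_toS]
  have := @dec_iff (x p.1) (y p.1)
  by_cases h : x p.1 = y p.1
  · simp [h]
  · have h' := dec_ne h
    simp only [h, h', ne_eq, not_false_eq_true, iff_true]
    cases p.2 <;> cases decide (y p.1 = 1) <;> simp

lemma mem_pair {n : ℕ} (i p : JJ n) : p ∈ ({i, starJ i} : Finset (JJ n)) ↔ p.1 = i.1 := by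
  obtain ⟨i, c⟩ := i
  obtain ⟨j, d⟩ := p
  simp only [Finset.mem_insert, Finset.mem_singleton, starJ, Prod.mk.injEq]
  cases c <;> cases d <;> simp

lemma mem_quad {n : ℕ} (i j p : JJ n) :
    p ∈ ({i, starJ i, j, starJ j} : Finset (JJ n)) ↔ p.1 = i.1 ∨ p.1 = j.1 := by
  rw [← mem_pair i p, ← mem_pair j p]
  simp only [Finset.mem_insert, Finset.mem_singleton]
  tauto

lemma symmDiff_pair_iff {n : ℕ} (x y : VV n) (i : JJ n) :
    symmDiff (toS x) (toS y) = ({i, starJ i} : Finset (JJ n)) ↔ y = x + ee i.1 := by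
  constructor
  · intro h
    ext k
    have hk := Finset.ext_iff.mp h (k, true)
    rw [mem_symmDiff_toS, mem_pair] at hk
    by_cases hki : k = i.1
    · rw [hki] at hk ⊢
      rw [ee_self]; exact (z2_one (hk.mpr rfl)).symm
    · rw [ee_ne _ hki]
      by_contra hne
      exact hki (hk.mp (Ne.symm hne))
  · rintro rfl
    ext p
    rw [mem_symmDiff_toS, mem_pair]
    by_cases hki : p.1 = i.1
    · rw [hki, ee_self]; simp
    · rw [ee_ne _ hki]; simp [hki]

lemma symmDiff_quad_iff {n : ℕ} (x y : VV n) (i j : JJ n) (hij : i.1 ≠ j.1) :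
    symmDiff (toS x) (toS y) = ({i, starJ i, j, starJ j} : Finset (JJ n)) ↔
      y = x + ee i.1 + ee j.1 := by
  constructor
  · intro h
    ext k
    have hk := Finset.ext_iff.mp h (k, true)
    rw [mem_symmDiff_toS, mem_quad] at hk
    by_cases hkj : k = j.1
    · rw [hkj] at hk ⊢
      rw [ee_self, ee_ne _ hij.symm]; exact (z2_one (hk.mpr (Or.inr rfl))).symm
    · rw [ee_ne _ hkj]
      by_cases hki : k = i.1
      · rw [hki] at hk ⊢
        rw [ee_self]; exact (z2_one (hk.mpr (Or.inl rfl))).symm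
      rw [ee_ne _ hki]
      by_contra hne
      rcases hk.mp (Ne.symm hne) with h | h
      · exact hki h
      · exact hkj h
  · rintro rfl
    ext p
    rw [mem_symmDiff_toS, mem_quad]
    by_cases hkj : p.1 = j.1
    · rw [hkj, ee_self, ee_ne _ hij.symm]; simp
    · rw [ee_ne _ hkj]
      by_cases hki : p.1 = i.1
      · rw [hki, ee_self]; simp
      · rw [ee_ne _ hki]; simp [hki, hkj]

lemma toS_flip {n : ℕ} (x : VV n) (i : JJ n) :
    symmDiff (toS x) ({i, starJ i} : Finset (JJ n)) = toS (x + ee i.1) := by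
  rw [← (symmDiff_pair_iff x (x + ee i.1) i).mpr rfl, symmDiff_symmDiff_cancel_left]

lemma toS_flip2 {n : ℕ} (x : VV n) (i j : JJ n) (hij : i.1 ≠ j.1) :
    symmDiff (toS x) ({i, starJ i, j, starJ j} : Finset (JJ n)) = toS (x + ee i.1 + ee j.1) := by
  rw [← (symmDiff_quad_iff x _ i j hij).mpr rfl, symmDiff_symmDiff_cancel_left]

def dd {n : ℕ} (F x : VV n) : ℕ := (Finset.univ.filter fun k => F k ≠ x k).card

lemma card_fst {n : ℕ} (x : VV n) (P : Fin n → Prop) [DecidablePred P] :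
    ((toS x).filter fun p => P p.1).card = (Finset.univ.filter P).card := by
  symm
  apply Finset.card_bij (fun i _ => (i, decide (x i = 1)))
  · intro i hi
    simp only [Finset.mem_filter, Finset.mem_univ, true_and] at hi
    simp [mem_toS, hi]
  · intro i _ j _ h; exact (Prod.ext_iff.mp h).1
  · rintro ⟨i, c⟩ hp
    rw [Finset.mem_filter, mem_toS] at hp
    exact ⟨i, by simpa using hp.2, by rw [Prod.ext_iff]; exact ⟨rfl, hp.1.symm⟩⟩

lemma heightF_toS {n : ℕ} (F x : VV n) : heightF (toS F) (toS x) = dd F x := by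
  unfold heightF dd
  have h1 : toS x ∩ toS F = (toS x).filter fun p => F p.1 = x p.1 := by
    ext p
    rw [Finset.mem_inter, Finset.mem_filter, mem_toS, mem_toS]
    constructor
    · rintro ⟨h, h'⟩
      exact ⟨h, dec_iff.mp (h'.symm.trans h)⟩
    · rintro ⟨h, h'⟩
      exact ⟨h, by rw [h']; exact h⟩
  rw [h1, card_fst x (fun k => F k = x k)]
  have := Finset.card_filter_add_card_filter_not (s := (Finset.univ : Finset (Fin n)))
    (fun k => F k = x k)
  rw [Finset.card_univ, Fintype.card_fin] at this
  refine Nat.sub_eq_of_eq_add' ?_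
  exact this.symm

lemma card_third {n : ℕ} (G H A : VV n) : (toS G \ (toS H ∪ toS A)).card =
    (Finset.univ.filter fun k => G k ≠ H k ∧ G k ≠ A k).card := by
  rw [← card_fst G (fun k => G k ≠ H k ∧ G k ≠ A k)]
  congr 1
  ext p
  rw [Finset.mem_sdiff, Finset.mem_union, Finset.mem_filter, mem_toS, mem_toS, mem_toS]
  constructor
  · rintro ⟨h, h'⟩
    push Not at h'
    exact ⟨h, fun e => h'.1 (by rw [h, e]), fun e => h'.2 (by rw [h, e])⟩
  · rintro ⟨h, h1, h2⟩
    refine ⟨h, ?_⟩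
    rintro (hoo | hoo)
    · exact h1 (dec_iff.mp (h.symm.trans hoo))
    · exact h2 (dec_iff.mp (h.symm.trans hoo))

/-! ### Maximality property gives the exchange property -/

lemma perm_sort {n : ℕ} (f : Fin n → ℕ) : ∃ r : Equiv.Perm (Fin n), ∀ i j, f i < f j → r i < r j := by
  refine ⟨(Tuple.sort f).symm, fun i j h => ?_⟩
  by_contra hlt
  push Not at hlt
  have := Tuple.monotone_sort f hlt
  simp only [Function.comp, Equiv.apply_symm_apply] at this
  omega

/-- the admissible permutation with `w⁻¹ (i, c) = (r i, xor c (decide (g i = 1)))`. -/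
def wInv {n : ℕ} (r : Equiv.Perm (Fin n)) (g : VV n) : Equiv.Perm (JJ n) where
  toFun p := (r p.1, xor p.2 (decide (g p.1 = 1)))
  invFun p := (r.symm p.1, xor p.2 (decide (g (r.symm p.1) = 1)))
  left_inv p := by simp
  right_inv p := by simp

lemma adm_wInv {n : ℕ} (r : Equiv.Perm (Fin n)) (g : VV n) : AdmissiblePerm (wInv r g).symm := by
  intro p
  rw [Equiv.symm_apply_eq]
  obtain ⟨q, rfl⟩ := (wInv r g).surjective p
  rw [Equiv.symm_apply_apply]
  simp [wInv, starJ]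

lemma upper_card {n : ℕ} {w : Equiv.Perm (JJ n)} {A B : Finset (JJ n)} (h : setLE w A B)
    (U : JJ n → Prop) (hU : ∀ x y, U x → leW w x y → U y) :
    (A.filter U).card ≤ (B.filter U).card := by
  obtain ⟨f, hf, hle⟩ := h
  apply Finset.card_le_card_of_injOn f
  · intro a ha
    simp only [Finset.coe_filter, Set.mem_ofPred_eq] at ha ⊢
    exact ⟨hf.mapsTo ha.1, hU _ _ ha.2 (hle a ha.1)⟩
  · intro a ha c hc hac
    simp only [Finset.coe_filter, Set.mem_ofPred_eq] at ha hc
    exact hf.injOn ha.1 hc.1 hac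

lemma toS_filter_card {n : ℕ} (x g : VV n) (Q : Fin n → Prop) :
    ((toS x).filter fun p => p.2 = decide (g p.1 = 1) ∧ Q p.1).card =
      (Finset.univ.filter fun k => x k = g k ∧ Q k).card := by
  rw [← card_fst x (fun k => x k = g k ∧ Q k)]
  congr 1
  ext p
  simp only [Finset.mem_filter, mem_toS]
  constructor
  · rintro ⟨h, h', h''⟩; exact ⟨h, dec_iff.mp (h.symm.trans h'), h''⟩
  · rintro ⟨h, h', h''⟩; exact ⟨h, by rw [h, h'], h''⟩

lemma exch_of_lagrangian {n : ℕ} {ℬ : Finset (Finset (JJ n))} (hM : IsLagrangianMatroid ℬ) :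
    Exch (fun x : VV n => toS x ∈ ℬ) := by
  intro A B hA hB i hi
  -- key: 2 outside, 1 at i, 0 else
  set f : Fin n → ℕ := fun k => if A k = B k then 2 else if k = i then 1 else 0 with hf
  obtain ⟨r, hr⟩ := perm_sort f
  set g : VV n := fun k => if k = i then B k else A k with hg
  obtain ⟨M', hM', hmax⟩ := hM.2 (wInv r g).symm (adm_wInv r g)
  obtain ⟨M, rfl⟩ : ∃ M, toS M = M' := ⟨chi M', toS_chi (hM.1 M' hM').1 (hM.1 M' hM').2⟩
  -- general upper sets
  have hup : ∀ m : ℕ, ∀ X : VV n, toS X ∈ ℬ →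
      (Finset.univ.filter fun k => X k = g k ∧ m ≤ f k).card ≤
      (Finset.univ.filter fun k => M k = g k ∧ m ≤ f k).card := by
    intro m X hX
    have q1 := toS_filter_card X g (fun k => m ≤ f k)
    have q2 := toS_filter_card M g (fun k => m ≤ f k)
    have hsub := upper_card (hmax _ hX) (fun p : JJ n => p.2 = decide (g p.1 = 1) ∧ m ≤ f p.1) ?_
    · refine le_trans (le_of_eq ?_) (le_trans hsub (le_of_eq ?_))
      · convert q1.symm
      · convert q2
    rintro ⟨a, c⟩ ⟨a', c'⟩ ⟨h1, h2⟩ hle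
    simp only at h1 h2
    rw [h1] at hle
    clear h1
    replace hle : ordJ (r a, xor (decide (g a = 1)) (decide (g a = 1))) ≤
        ordJ (r a', xor c' (decide (g a' = 1))) := hle
    rw [Bool.xor_self] at hle
    have hc' : c' = decide (g a' = 1) := by
      by_contra hne
      have : (c' ^^ decide (g a' = 1)) = true := by
        revert hne; cases c' <;> cases decide (g a' = 1) <;> simp
      rw [this] at hle
      simp only [ordJ] at hle
      have h0 : (0 : ℤ) ≤ ((r a : ℕ) : ℤ) := by positivity
      have h0' : (0 : ℤ) ≤ ((r a' : ℕ) : ℤ) := by positivity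
      simp at hle
      omega
    refine ⟨hc', ?_⟩
    rw [hc', Bool.xor_self] at hle
    simp [ordJ] at hle
    simp only
    by_contra hlt
    have := hr a' a (by omega)
    exact absurd this (not_lt.mpr hle)
  have hgi : g i = B i := by simp [hg]
  have hgk : ∀ k, k ≠ i → g k = A k := fun k hk => by simp [hg, hk]
  have hfi : f i = 1 := by simp [hf, hi]
  have all_of : ∀ m X, toS X ∈ ℬ → (∀ k, m ≤ f k → X k = g k) → ∀ k, m ≤ f k → M k = g k := by
    intro m X hX hXg k hk
    have h1 := hup m X hX
    have h2 : (Finset.univ.filter fun k => M k = g k ∧ m ≤ f k) ⊆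
        (Finset.univ.filter fun k => X k = g k ∧ m ≤ f k) := by
      intro l; simp only [Finset.mem_filter, Finset.mem_univ, true_and]
      rintro ⟨-, h⟩; exact ⟨hXg l h, h⟩
    have h3 := Finset.eq_of_subset_of_card_le h2 h1
    have : k ∈ (Finset.univ.filter fun k => M k = g k ∧ m ≤ f k) := by
      rw [h3]; simp [hk, hXg k hk]
    simpa [hk] using this
  have hMtop : ∀ k, 1 ≤ f k → M k = g k := by
    apply all_of 1 B hB
    intro k hk
    by_cases hki : k = i
    · rw [hki, hgi]
    · rw [hgk k hki]
      by_contra hne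
      have : f k = 0 := by simp [hf, hki, Ne.symm hne]
      omega
  have hMi : M i = B i := by rw [hMtop i (by omega), hgi]
  have hMout : ∀ k, A k = B k → M k = A k := by
    intro k hk
    have hki : k ≠ i := fun h => hi (h ▸ hk)
    rw [hMtop k (by simp [hf, hk]), hgk k hki]
  -- at most one more change
  have hcard := hup 0 A hA
  simp only [Nat.zero_le, and_true] at hcard
  have hA' : (Finset.univ.filter fun k => A k = g k) = Finset.univ.erase i := by
    ext k
    simp only [Finset.mem_filter, Finset.mem_univ, true_and, Finset.mem_erase, and_true]
    constructor
    · intro h hk; subst hk; exact hi (h.trans hgi)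
    · intro h; exact (hgk k h).symm
  rw [hA'] at hcard
  have hcompl : (Finset.univ.filter fun k => ¬ M k = g k).card ≤ 1 := by
    have h1 := Finset.card_filter_add_card_filter_not (s := (Finset.univ : Finset (Fin n)))
      (fun k => M k = g k)
    rw [Finset.card_erase_of_mem (Finset.mem_univ _)] at hcard
    have hpos : 0 < (Finset.univ : Finset (Fin n)).card := Finset.card_pos.mpr ⟨i, Finset.mem_univ _⟩
    omega
  have hAi : A i + 1 = B i := z2_one hi
  by_cases hall : ∀ k, M k = g k
  · left
    have : M = A + ee i := by
      ext k
      by_cases hki : k = i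
      · rw [hki, hMi, ee_self, hAi]
      · rw [hall k, hgk k hki, ee_ne _ hki]
    exact this ▸ hM'
  · right
    push Not at hall
    obtain ⟨z, hz⟩ := hall
    have hzi : z ≠ i := by rintro rfl; exact hz (hMi.trans hgi.symm)
    have huniq : ∀ k, M k ≠ g k → k = z := by
      intro k hk
      exact Finset.card_le_one.mp hcompl k (by simp [hk]) z (by simp [hz])
    refine ⟨z, hzi, ?_, ?_⟩
    · intro h
      exact hz ((hMout z h).trans (hgk z hzi).symm)
    · have : M = A + ee i + ee z := by
        ext k
        by_cases hkz : k = z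
        · rw [hkz, ee_self, ee_ne _ hzi]
          exact (z2_one (fun h => hz (h.symm.trans (hgk z hzi).symm))).symm
        · rw [ee_ne _ hkz]
          by_cases hki : k = i
          · rw [hki, hMi, ee_self, hAi]
          · rw [ee_ne _ hki, ← hgk k hki]
            by_contra hne
            exact hkz (huniq k hne)
      exact this ▸ hM'


/-! ### Edges of the polytope -/

noncomputable def vl {n : ℕ} (l : Fin n → ℝ) (x : VV n) : ℝ := ∑ k, l k * sg (x k)

noncomputable def Lof {n : ℕ} (l : Fin n → ℝ) : (Fin n → ℝ) →ₗ[ℝ] ℝ :=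
  ∑ k, l k • LinearMap.proj k

lemma Lof_apply {n : ℕ} (l y : Fin n → ℝ) : Lof l y = ∑ k, l k * y k := by
  simp [Lof]

lemma Lof_toS {n : ℕ} (l : Fin n → ℝ) (x : VV n) : Lof l (eSet (toS x)) = vl l x := by
  rw [Lof_apply, vl]; simp only [eSet_toS]

lemma lin_toS {n : ℕ} (L : (Fin n → ℝ) →ₗ[ℝ] ℝ) (x : VV n) :
    L (eSet (toS x)) = vl (fun i => L (Pi.single i 1)) x := by
  rw [LinearMap.pi_apply_eq_sum_univ L]
  unfold vl
  refine Finset.sum_congr rfl fun k _ => ?_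
  rw [eSet_toS, smul_eq_mul, mul_comm]
  congr 2
  ext j
  simp [Pi.single_apply, eq_comm]

lemma val_flip {n : ℕ} (l : Fin n → ℝ) (x : VV n) (i : Fin n) :
    vl l (x + ee i) = vl l x - 2 * (l i * sg (x i)) := by
  have : vl l (x + ee i) - vl l x = - 2 * (l i * sg (x i)) := by
    unfold vl
    rw [← Finset.sum_sub_distrib, Finset.sum_eq_single i]
    · rw [ee_self, sg_flip]; ring
    · intro k _ hk; rw [ee_ne _ hk]; ring
    · simp
  linarith

lemma val_flip2 {n : ℕ} (l : Fin n → ℝ) (x : VV n) {i j : Fin n} (h : i ≠ j) :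
    vl l (x + ee i + ee j) = vl l x - 2 * (l i * sg (x i)) - 2 * (l j * sg (x j)) := by
  rw [val_flip, val_flip, ee_ne _ h.symm]

/-- functional with weights `w` adapted to the vertex `A`. -/
noncomputable def lw {n : ℕ} (A : VV n) (w : Fin n → ℝ) : Fin n → ℝ := fun k => w k * sg (A k)

lemma gap {n : ℕ} (A C : VV n) (w : Fin n → ℝ) :
    vl (lw A w) A - vl (lw A w) C = ∑ k, if A k = C k then 0 else 2 * w k := by
  unfold vl lw
  rw [← Finset.sum_sub_distrib]
  refine Finset.sum_congr rfl fun k _ => ?_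
  split_ifs with h
  · rw [h]; ring
  · rw [sg_ne h]
    have := sg_sq (A k)
    linear_combination 2 * w k * this

lemma edge_short {n : ℕ} {ℬ : Finset (Finset (JJ n))} {A : VV n} {i : Fin n}
    (h1 : toS A ∈ ℬ) (h2 : toS (A + ee i) ∈ ℬ) (hB : ∀ C ∈ ℬ, ∃ x, toS x = C) :
    IsEdge ℬ (toS A) (toS (A + ee i)) := by
  refine ⟨h1, h2, ?_, Lof (lw A fun k => if k = i then 0 else 1), ?_, ?_⟩
  · intro h
    have := congrFun (toS_inj h) i
    exact ee_self_ne A i this.symm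
  · rw [Lof_toS, Lof_toS, val_flip]
    simp [lw]
  · intro C hC hCA hCB
    obtain ⟨x, rfl⟩ := hB C hC
    rw [Lof_toS, Lof_toS, ← sub_pos, gap]
    have hk : ∃ k, k ≠ i ∧ A k ≠ x k := by
      by_contra hcon
      push Not at hcon
      by_cases hi : A i = x i
      · apply hCA; congr 1; ext k
        by_cases hk : k = i
        · rw [hk, hi]
        · exact (hcon k hk).symm
      · apply hCB; congr 1; ext k
        by_cases hk : k = i
        · rw [hk, ee_self, z2_one hi]
        · rw [ee_ne _ hk]; exact (hcon k hk).symm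
    obtain ⟨k, hk, hAk⟩ := hk
    apply Finset.sum_pos'
    · intro j _; split_ifs <;> norm_num
    · exact ⟨k, Finset.mem_univ _, by simp [hk, hAk]⟩

lemma edge_long_aux {n : ℕ} {ℬ : Finset (Finset (JJ n))} {A : VV n} {i j : Fin n} (hij : i ≠ j)
    (h1 : toS A ∈ ℬ) (h2 : toS (A + ee i + ee j) ∈ ℬ) (hB : ∀ C ∈ ℬ, ∃ x, toS x = C)
    (h3 : toS (A + ee i) ∉ ℬ) :
    IsEdge ℬ (toS A) (toS (A + ee i + ee j)) := by
  set w : Fin n → ℝ := fun k => if k = i then -1/2 else if k = j then 1/2 else 1 with hw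
  have hwi : w i = -1/2 := by simp [hw]
  have hwj : w j = 1/2 := by simp [hw, hij.symm]
  refine ⟨h1, h2, ?_, Lof (lw A w), ?_, ?_⟩
  · intro h
    have := congrFun (toS_inj h) j
    rw [ee_self, ee_ne _ hij.symm] at this
    exact z2_ne _ this.symm
  · rw [Lof_toS, Lof_toS, val_flip2 _ _ hij]
    simp only [lw, hwi, hwj]
    linear_combination (-1) * sg_sq (A i) + sg_sq (A j)
  · intro C hC hCA hCB
    obtain ⟨x, rfl⟩ := hB C hC
    rw [Lof_toS, Lof_toS, ← sub_pos, gap]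
    rw [← Finset.add_sum_erase _ _ (Finset.mem_univ i),
      ← Finset.add_sum_erase _ _ (Finset.mem_erase.mpr ⟨hij.symm, Finset.mem_univ j⟩), hwi, hwj]
    have hnn : ∀ k ∈ (Finset.univ.erase i).erase j, (0 : ℝ) ≤ if A k = x k then 0 else 2 * w k := by
      intro k hk
      simp only [Finset.mem_erase, Finset.mem_univ, and_true] at hk
      split_ifs
      · exact le_rfl
      · simp [hw, hk.1, hk.2]
    by_cases hk : ∃ k, k ≠ i ∧ k ≠ j ∧ A k ≠ x k
    · obtain ⟨k, hki, hkj, hk⟩ := hk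
      have := Finset.single_le_sum hnn
        (Finset.mem_erase.mpr ⟨hkj, Finset.mem_erase.mpr ⟨hki, Finset.mem_univ k⟩⟩)
      rw [if_neg hk] at this
      have hwk : w k = 1 := by simp [hw, hki, hkj]
      rw [hwk] at this
      split_ifs <;> linarith
    · push Not at hk
      have := Finset.sum_nonneg hnn
      by_cases hi : A i = x i
      · by_cases hj : A j = x j
        · exfalso; apply hCA; congr 1; ext k
          by_cases hki : k = i
          · rw [hki, hi]
          by_cases hkj : k = j
          · rw [hkj, hj]
          exact (hk k hki hkj).symm
        · rw [if_pos hi, if_neg hj]; linarith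
      · exfalso
        by_cases hj : A j = x j
        · apply h3
          convert hC using 2
          ext k
          by_cases hki : k = i
          · rw [hki, ee_self, z2_one hi]
          rw [ee_ne _ hki]
          by_cases hkj : k = j
          · rw [hkj, hj]
          exact hk k hki hkj
        · apply hCB; congr 1; ext k
          by_cases hkj : k = j
          · rw [hkj, ee_self, ee_ne _ hij.symm, z2_one hj]
          rw [ee_ne _ hkj]
          by_cases hki : k = i
          · rw [hki, ee_self, z2_one hi]
          rw [ee_ne _ hki]
          exact (hk k hki hkj).symm

lemma edge_long {n : ℕ} {ℬ : Finset (Finset (JJ n))} {A : VV n} {i j : Fin n} (hij : i ≠ j)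
    (h1 : toS A ∈ ℬ) (h2 : toS (A + ee i + ee j) ∈ ℬ) (hB : ∀ C ∈ ℬ, ∃ x, toS x = C)
    (h3 : ¬ (toS (A + ee i) ∈ ℬ ∧ toS (A + ee j) ∈ ℬ)) :
    IsEdge ℬ (toS A) (toS (A + ee i + ee j)) := by
  by_cases h : toS (A + ee i) ∈ ℬ
  · have h4 : toS (A + ee j) ∉ ℬ := fun h' => h3 ⟨h, h'⟩
    have e : A + ee i + ee j = A + ee j + ee i := by abel
    rw [e] at h2 ⊢
    exact edge_long_aux hij.symm h1 h2 hB h4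
  · exact edge_long_aux hij h1 h2 hB h

lemma edge_cases {n : ℕ} {ℬ : Finset (Finset (JJ n))} (hE : Exch (fun x : VV n => toS x ∈ ℬ))
    {A B : VV n} (h : IsEdge ℬ (toS A) (toS B)) :
    (∃ i, B = A + ee i) ∨ ∃ i j, i ≠ j ∧ B = A + ee i + ee j ∧
      ¬ (toS (A + ee i) ∈ ℬ ∧ toS (A + ee j) ∈ ℬ) := by
  obtain ⟨hA, hB, hne, L, hL, hlt⟩ := h
  set l := fun i => L (Pi.single i 1) with hl
  have hAB : A ≠ B := fun h => hne (h ▸ rfl)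
  have hv : vl l A = vl l B := by rw [hl, ← lin_toS, ← lin_toS, hL]
  have hx : ∀ x, toS x ∈ ℬ → x ≠ A → x ≠ B → vl l x < vl l A := by
    intro x h1 h2 h3
    rw [hl, ← lin_toS, ← lin_toS]
    exact hlt _ h1 (fun h => h2 (toS_inj h)) (fun h => h3 (toS_inj h))
  set D := Finset.univ.filter fun k => A k ≠ B k with hD
  have hmem : ∀ k, k ∈ D ↔ A k ≠ B k := fun k => by simp [hD]
  have hDne : D.Nonempty := by
    obtain ⟨i, hi⟩ := Function.ne_iff.mp hAB
    exact ⟨i, (hmem i).mpr hi⟩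
  by_cases hc : 3 ≤ D.card
  · exfalso
    obtain ⟨i, hiD, himax⟩ := Finset.exists_max_image D (fun k => |l k * sg (A k)|) hDne
    have hthird : ∀ z, ∃ k ∈ D, k ≠ i ∧ k ≠ z := by
      intro z
      have : ({i, z} : Finset (Fin n)).card < D.card := lt_of_le_of_lt Finset.card_le_two hc
      obtain ⟨k, hk, hk'⟩ := Finset.exists_mem_notMem_of_card_lt_card this
      simp at hk'
      exact ⟨k, hk, hk'.1, hk'.2⟩
    have hi := (hmem i).mp hiD
    have sgB : ∀ k, A k ≠ B k → sg (B k) = - sg (A k) := fun k hk => sg_ne hk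
    by_cases hs : l i * sg (A i) ≤ 0
    · rcases hE A B hA hB i hi with hb | ⟨z, hz, hzD, hb⟩
      · obtain ⟨k, hk, hki, -⟩ := hthird i
        have := hx _ hb (fun e => ee_self_ne A i (congrFun e i))
          (fun e => (hmem k).mp hk (by rw [← e, ee_ne _ hki]))
        rw [val_flip] at this
        linarith
      · obtain ⟨k, hk, hki, hkz⟩ := hthird z
        have := hx _ hb (fun e => by
            have := congrFun e z
            rw [ee_self, ee_ne _ hz] at this
            exact z2_ne _ this)
          (fun e => (hmem k).mp hk (by rw [← e, ext_two hki hkz]))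
        rw [val_flip2 _ _ hz.symm] at this
        have h2 := himax z ((hmem z).mpr hzD)
        simp only [abs_of_nonpos hs] at h2
        have := (abs_le.mp h2).2
        linarith
    · push Not at hs
      rcases hE B A hB hA i hi.symm with hb | ⟨z, hz, hzD, hb⟩
      · obtain ⟨k, hk, hki, -⟩ := hthird i
        have := hx _ hb (fun e => (hmem k).mp hk (by rw [← e, ee_ne _ hki]))
          (fun e => ee_self_ne B i (congrFun e i))
        rw [val_flip, sgB i hi] at this
        linarith
      · obtain ⟨k, hk, hki, hkz⟩ := hthird z
        have := hx _ hb (fun e => (hmem k).mp hk (by rw [← e, ext_two hki hkz]))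
          (fun e => by
            have := congrFun e z
            rw [ee_self, ee_ne _ hz] at this
            exact z2_ne _ this)
        rw [val_flip2 _ _ hz.symm, sgB i hi, sgB z hzD.symm] at this
        have h2 := himax z ((hmem z).mpr hzD.symm)
        simp only [abs_of_pos hs] at h2
        have := (abs_le.mp h2).1
        linarith
  · have hpos := hDne.card_pos
    have : D.card = 1 ∨ D.card = 2 := by omega
    rcases this with h1 | h2
    · obtain ⟨i, hi⟩ := Finset.card_eq_one.mp h1
      left
      refine ⟨i, ?_⟩
      ext k
      have hk := hmem k
      rw [hi, Finset.mem_singleton] at hk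
      by_cases hki : k = i
      · rw [hki, ee_self, ← hki, z2_one (hk.mp hki)]
      · rw [ee_ne _ hki]
        by_contra hne
        exact hki (hk.mpr (Ne.symm hne))
    · obtain ⟨i, j, hij, hi⟩ := Finset.card_eq_two.mp h2
      right
      have hBe : B = A + ee i + ee j := by
        ext k
        have hk := hmem k
        rw [hi, Finset.mem_insert, Finset.mem_singleton] at hk
        by_cases hkj : k = j
        · rw [hkj, ee_self, ee_ne _ hij.symm, ← hkj, z2_one (hk.mp (Or.inr hkj))]
        rw [ee_ne _ hkj]
        by_cases hki : k = i
        · rw [hki, ee_self, ← hki, z2_one (hk.mp (Or.inl hki))]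
        · rw [ee_ne _ hki]
          by_contra hne
          rcases hk.mpr (Ne.symm hne) with h | h
          · exact hki h
          · exact hkj h
      refine ⟨i, j, hij, hBe, ?_⟩
      rintro ⟨hi', hj'⟩
      have e1 := hx _ hi' (fun e => ee_self_ne A i (congrFun e i)) (fun e => by
        have := congrFun e j
        rw [hBe, ee_self] at this
        exact z2_ne _ this.symm)
      have e2' := hx _ hj' (fun e => ee_self_ne A j (congrFun e j)) (fun e => by
        have := congrFun e i
        rw [hBe, ee_ne _ hij, ee_ne _ hij, ee_self] at this
        exact z2_ne _ this.symm)
      rw [hBe, val_flip2 _ _ hij] at hv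
      rw [val_flip] at e1 e2'
      linarith

lemma short_iff {n : ℕ} {ℬ : Finset (Finset (JJ n))} (hB : ∀ C ∈ ℬ, ∃ x, toS x = C)
    {A B : VV n} : IsShortEdge ℬ (toS A) (toS B) ↔
      toS A ∈ ℬ ∧ toS B ∈ ℬ ∧ ∃ i, B = A + ee i := by
  constructor
  · rintro ⟨h, i, hi⟩
    exact ⟨h.1, h.2.1, i.1, (symmDiff_pair_iff A B i).mp hi⟩
  · rintro ⟨h1, h2, i, rfl⟩
    exact ⟨edge_short h1 h2 hB, (i, true), (symmDiff_pair_iff A _ (i, true)).mpr rfl⟩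

lemma e_two_ne_one {n : ℕ} {A : VV n} {i j k : Fin n} (hij : i ≠ j)
    (h : A + ee i + ee j = A + ee k) : False := by
  by_cases hk : k = i
  · have := congrFun h j
    rw [ee_self, ee_ne _ hij.symm, ee_ne _ (hk ▸ hij.symm)] at this
    exact z2_ne _ this
  · have := congrFun h i
    rw [ee_ne _ hij, ee_self, ee_ne _ (Ne.symm hk)] at this
    exact z2_ne _ this

lemma long_iff {n : ℕ} {ℬ : Finset (Finset (JJ n))} (hE : Exch (fun x : VV n => toS x ∈ ℬ))
    (hB : ∀ C ∈ ℬ, ∃ x, toS x = C)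
    {A B : VV n} : IsLongEdge ℬ (toS A) (toS B) ↔
      toS A ∈ ℬ ∧ toS B ∈ ℬ ∧ ∃ i j, i ≠ j ∧ B = A + ee i + ee j ∧
      ¬ (toS (A + ee i) ∈ ℬ ∧ toS (A + ee j) ∈ ℬ) := by
  constructor
  · rintro ⟨h, i, j, hij, hij', hs⟩
    refine ⟨h.1, h.2.1, ?_⟩
    have hne : i.1 ≠ j.1 := by
      intro e
      rcases i with ⟨i, c⟩
      rcases j with ⟨j, d⟩
      simp only at e
      subst e
      cases c <;> cases d <;> simp [starJ] at hij hij'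
    have hs' := (symmDiff_quad_iff A B i j hne).mp hs
    rcases edge_cases hE h with ⟨k, hk⟩ | h'
    · exact absurd (hs'.symm.trans hk) (fun e => e_two_ne_one hne e)
    · exact h'
  · rintro ⟨h1, h2, i, j, hij, rfl, h3⟩
    refine ⟨edge_long hij h1 h2 hB h3, (i, true), (j, true), ?_, ?_, ?_⟩
    · simp [hij]
    · simp [starJ]
    · exact (symmDiff_quad_iff A _ (i, true) (j, true) hij).mpr rfl


/-! ### Signs -/

def pp {n : ℕ} (x : VV n) : ℤ := ∏ i, if x i = 1 then (-1 : ℤ) else 1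

lemma pp_sq {n : ℕ} (x : VV n) : pp x * pp x = 1 := by
  unfold pp
  rw [← Finset.prod_mul_distrib]
  apply Finset.prod_eq_one
  intro i _
  split_ifs <;> norm_num

def uu : ℕ → ℤ
  | 0 => 1
  | h + 1 => uu h * (-1) ^ h

lemma uu_sq (h : ℕ) : uu h * uu h = 1 := by
  induction h with
  | zero => rfl
  | succ h ih =>
    simp only [uu]
    have : ((-1 : ℤ) ^ h) * (-1) ^ h = 1 := by rw [← mul_pow]; norm_num
    linear_combination ((-1 : ℤ) ^ h) * (-1) ^ h * ih + this

lemma uu_add (a c : ℕ) : uu (a + c) = uu a * uu c * (-1) ^ (a * c) := by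
  induction c with
  | zero => simp [uu]
  | succ c ih =>
    rw [← add_assoc]
    simp only [uu]
    rw [ih, pow_add, Nat.mul_succ, pow_add]
    ring

def kap {n : ℕ} (F A : VV n) : ℤ := uu (dd F A) * pp F ^ (dd F A)

lemma pp_pow_sq {n : ℕ} (F : VV n) (h : ℕ) : pp F ^ h * pp F ^ h = 1 := by
  rw [← mul_pow, pp_sq, one_pow]

lemma kap_sq {n : ℕ} (F A : VV n) : kap F A * kap F A = 1 := by
  unfold kap
  linear_combination pp F ^ (dd F A) * pp F ^ (dd F A) * uu_sq (dd F A) + pp_pow_sq F (dd F A)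

lemma dd_self {n : ℕ} (F : VV n) : dd F F = 0 := by simp [dd]

lemma kap_self {n : ℕ} (F : VV n) : kap F F = 1 := by
  simp [kap, dd_self, uu]

lemma pp_dd {n : ℕ} (G H : VV n) : pp G = pp H * (-1) ^ (dd H G) := by
  unfold pp dd
  rw [Finset.card_filter, ← Finset.prod_pow_eq_pow_sum, ← Finset.prod_mul_distrib]
  refine Finset.prod_congr rfl fun k _ => ?_
  rcases z2_cases (G k) with h | h <;> rcases z2_cases (H k) with h' | h' <;> rw [h, h'] <;> simp

lemma dd_third {n : ℕ} (G H A : VV n) : dd G H =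
    (Finset.univ.filter fun k => G k ≠ H k ∧ G k ≠ A k).card +
    (Finset.univ.filter fun k => H k ≠ G k ∧ H k ≠ A k).card := by
  unfold dd
  rw [Finset.card_filter, Finset.card_filter, Finset.card_filter, ← Finset.sum_add_distrib]
  refine Finset.sum_congr rfl fun k _ => ?_
  rcases z2_cases (G k) with h | h <;> rcases z2_cases (H k) with h' | h' <;>
    rcases z2_cases (A k) with h'' | h'' <;> rw [h, h', h''] <;> simp

lemma kap_cocycle {n : ℕ} (G H A : VV n) : kap G A = kap H A * kap H G *
    (-1) ^ (Finset.univ.filter fun k => G k ≠ H k ∧ G k ≠ A k).card := by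
  set q := (Finset.univ.filter fun k => G k ≠ H k ∧ G k ≠ A k).card with hq
  set r := (Finset.univ.filter fun k => H k ≠ G k ∧ H k ≠ A k).card with hr
  set a := (Finset.univ.filter fun k => A k ≠ H k ∧ A k ≠ G k).card with ha
  have h1 : dd H A = a + r := by
    rw [dd_third H A G, add_comm, ha, hr]
    congr 3
    ext k; simp [and_comm]
  have h2 : dd H G = q + r := by rw [dd_third H G A, add_comm]
  have h3 : dd G A = a + q := by
    rw [dd_third G A H, add_comm, ha, hq]
    congr 3 <;> ext k <;> simp [and_comm]
  unfold kap
  rw [pp_dd G H, h1, h2, h3]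
  simp only [uu_add]
  have hpr := pp_pow_sq H r
  have hur := uu_sq r
  have e1 : (pp H * (-1) ^ (q + r)) ^ (a + q) =
      pp H ^ a * pp H ^ q * ((-1) ^ (a * q) * (-1) ^ (r * a) * (-1) ^ (q * r) * (-1) ^ q) := by
    rw [mul_pow, pow_add (pp H), ← pow_mul]
    congr 1
    have : (q + r) * (a + q) = a * q + r * a + q * r + q * q := by ring
    rw [this, pow_add, pow_add, pow_add]
    congr 1
    rcases Nat.even_or_odd q with hh | hh
    · rw [hh.neg_one_pow, (hh.mul_left q).neg_one_pow]
    · rw [hh.neg_one_pow, (hh.mul hh).neg_one_pow]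
  have e2 : ((-1 : ℤ) ^ (a * q)) * (-1) ^ (a * q) = 1 := by rw [← mul_pow]; norm_num
  rw [e1, pow_add, pow_add, mul_comm a r]
  linear_combination (uu a * uu q * pp H ^ a * pp H ^ q * (-1) ^ (r * a) * (-1) ^ (q * r) * (-1) ^ q) *
    (e2 - hpr - pp H ^ r * pp H ^ r * hur)

lemma dd_up {n : ℕ} {F A : VV n} {i : Fin n} (h : F i = A i) : dd F (A + ee i) = dd F A + 1 := by
  unfold dd
  rw [← Finset.card_insert_of_notMem (a := i) (s := Finset.univ.filter fun k => F k ≠ A k)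
    (by simp [h])]
  congr 1
  ext k
  by_cases hk : k = i
  · subst hk
    rw [Finset.mem_filter, Finset.mem_insert]
    simp only [Finset.mem_univ, true_and, true_or, iff_true]
    rw [h]; exact (ee_self_ne A k).symm
  · rw [Finset.mem_filter, Finset.mem_insert, Finset.mem_filter, ee_ne _ hk]
    simp [hk]

lemma dd_down {n : ℕ} {F A : VV n} {i : Fin n} (h : F i ≠ A i) : dd F A = dd F (A + ee i) + 1 := by
  rw [← dd_up (F := F) (A := A + ee i) (i := i), ee_cancel]
  rw [ee_self]; exact (z2_one h.symm).symm

lemma pp_flip {n : ℕ} (A : VV n) (i : Fin n) : pp (A + ee i) = - pp A := by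
  rw [pp_dd (A + ee i) A, dd_up rfl, dd_self]; simp

lemma kap_up {n : ℕ} {F A : VV n} {i : Fin n} (h : F i = A i) :
    kap F A * kap F (A + ee i) = pp A := by
  rw [pp_dd A F]
  unfold kap
  rw [dd_up h]
  simp only [uu, pow_succ]
  linear_combination (pp F ^ dd F A * pp F ^ dd F A * pp F * (-1) ^ dd F A) * uu_sq (dd F A) +
    pp F * (-1) ^ dd F A * pp_pow_sq F (dd F A)

lemma kap_down {n : ℕ} {F A : VV n} {i : Fin n} (h : F i ≠ A i) :
    kap F A * kap F (A + ee i) = - pp A := by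
  have := kap_up (F := F) (A := A + ee i) (i := i)
    (by rw [ee_self]; exact (z2_one h.symm).symm)
  rw [ee_cancel, pp_flip] at this
  rw [mul_comm]; exact this

lemma kap_one {n : ℕ} (A : VV n) (i : Fin n) : kap A (A + ee i) = pp A := by
  have := kap_up (F := A) (A := A) (i := i) rfl
  rwa [kap_self, one_mul] at this

lemma kap_two {n : ℕ} (F A : VV n) {i j : Fin n} (hij : i ≠ j) :
    (dd F A = dd F (A + ee i + ee j) ∧ kap F A * kap F (A + ee i + ee j) = 1) ∨
    (dd F A ≠ dd F (A + ee i + ee j) ∧ kap F A * kap F (A + ee i + ee j) = -1) := by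
  have hj : (A + ee i) j = A j := ee_ne _ hij.symm
  have hs := kap_sq F (A + ee i)
  have hp := pp_sq A
  by_cases h1 : F i = A i <;> by_cases h2 : F j = A j
  · right
    have a1 := kap_up h1
    have a2 := kap_up (h2.trans hj.symm)
    have d1 := dd_up h1
    have d2 := dd_up (h2.trans hj.symm)
    rw [pp_flip] at a2
    refine ⟨by omega, ?_⟩
    linear_combination kap F (A + ee i) * kap F (A + ee i + ee j) * a1 + pp A * a2 - hp -
      kap F A * kap F (A + ee i + ee j) * hs
  · left
    have h2' : F j ≠ (A + ee i) j := by rw [hj]; exact h2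
    have a1 := kap_up h1
    have a2 := kap_down h2'
    have d1 := dd_up h1
    have d2 := dd_down h2'
    rw [pp_flip] at a2
    refine ⟨by omega, ?_⟩
    linear_combination kap F (A + ee i) * kap F (A + ee i + ee j) * a1 + pp A * a2 + hp -
      kap F A * kap F (A + ee i + ee j) * hs
  · left
    have a1 := kap_down h1
    have a2 := kap_up (h2.trans hj.symm)
    have d1 := dd_down h1
    have d2 := dd_up (h2.trans hj.symm)
    rw [pp_flip] at a2
    refine ⟨by omega, ?_⟩
    linear_combination kap F (A + ee i) * kap F (A + ee i + ee j) * a1 - pp A * a2 + hp -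
      kap F A * kap F (A + ee i + ee j) * hs
  · right
    have h2' : F j ≠ (A + ee i) j := by rw [hj]; exact h2
    have a1 := kap_down h1
    have a2 := kap_down h2'
    have d1 := dd_down h1
    have d2 := dd_down h2'
    rw [pp_flip] at a2
    refine ⟨by omega, ?_⟩
    linear_combination kap F (A + ee i) * kap F (A + ee i + ee j) * a1 - pp A * a2 - hp -
      kap F A * kap F (A + ee i + ee j) * hs


/-! ### Potentials and orientations -/

structure Pt {n : ℕ} (ℬ : Finset (Finset (JJ n))) (t : VV n → ℤ) : Prop where
  one : ∀ A, toS A ∈ ℬ → t A * t A = 1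
  long : ∀ A i j, i ≠ j → toS A ∈ ℬ → toS (A + ee i + ee j) ∈ ℬ →
    ¬ (toS (A + ee i) ∈ ℬ ∧ toS (A + ee j) ∈ ℬ) → t A = t (A + ee i + ee j)
  sq : ∀ A i j, i ≠ j → toS A ∈ ℬ → toS (A + ee i) ∈ ℬ → toS (A + ee j) ∈ ℬ →
    toS (A + ee i + ee j) ∈ ℬ → t A = t (A + ee i + ee j) ∨ t (A + ee i) = t (A + ee j)

noncomputable def sOf {n : ℕ} (ℬ : Finset (Finset (JJ n))) (t : VV n → ℤ)
    (G A : Finset (JJ n)) : ℤ :=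
  if G ∈ ℬ ∧ A ∈ ℬ then t (chi A) * t (chi G) * kap (chi G) (chi A) else 0

lemma chi_toS {n : ℕ} (x : VV n) : chi (toS x) = x := by
  ext i
  rcases z2_cases (x i) with h | h <;> simp [chi, mem_toS, h]

lemma sOf_toS {n : ℕ} {ℬ : Finset (Finset (JJ n))} (t : VV n → ℤ) {G A : VV n}
    (hG : toS G ∈ ℬ) (hA : toS A ∈ ℬ) : sOf ℬ t (toS G) (toS A) = t A * t G * kap G A := by
  simp [sOf, hG, hA, chi_toS]

lemma sgn_cases {a : ℤ} (h : a * a = 1) : a = 1 ∨ a = -1 := mul_self_eq_one_iff.mp h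

lemma all4 {P : Fin 4 → Prop} (h0 : P 0) (h1 : P 1) (h2 : P 2) (h3 : P 3) : ∀ l, P l := by
  intro l; fin_cases l <;> assumption

lemma sq_comb (S : Fin 4 → ℤ) (h : Fin 4 → ℕ) (k : Fin 4) (one : ∀ l, S l = 1 ∨ S l = -1)
    (H : (h 1 = h 2 ∧ ((h 0 < h 1 ∧ h 1 < h 3) ∨ (h 3 < h 1 ∧ h 1 < h 0)) ∧
        (S 0 ≠ S 3 ∨ S 1 = S 2)) ∨
      (h 0 = h 3 ∧ ((h 1 < h 0 ∧ h 0 < h 2) ∨ (h 2 < h 0 ∧ h 0 < h 1)) ∧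
        (S 0 = S 3 ∨ S 1 ≠ S 2)))
    (hk : ∀ l m : Fin 4, l ≠ k → m ≠ k → S l = S m) (hl : ∃ l : Fin 4, l ≠ k ∧ S l ≠ S k) :
    (∀ l, h l ≤ h k) ∨ (∀ l, h k ≤ h l) := by
  obtain ⟨l, hlk, hl⟩ := hl
  have o0 := one 0; have o1 := one 1; have o2 := one 2; have o3 := one 3
  have hl' : ∀ m, m ≠ k → S m ≠ S k := fun m hm => hk m l hm hlk ▸ hl
  clear hl hlk
  have key : ((h 0 ≤ h k ∧ h 1 ≤ h k ∧ h 2 ≤ h k ∧ h 3 ≤ h k) ∨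
      (h k ≤ h 0 ∧ h k ≤ h 1 ∧ h k ≤ h 2 ∧ h k ≤ h 3)) := by
    fin_cases k
    · have a1 := hl' 1 (by decide); have a2 := hl' 2 (by decide); have a3 := hl' 3 (by decide)
      have b1 := hk 1 2 (by decide) (by decide)
      simp only [Fin.zero_eta, Fin.isValue] at *
      omega
    · have a1 := hl' 0 (by decide); have a2 := hl' 2 (by decide); have a3 := hl' 3 (by decide)
      have b1 := hk 0 3 (by decide) (by decide)
      simp only [Fin.mk_one, Fin.isValue] at *
      omega
    · have a1 := hl' 0 (by decide); have a2 := hl' 1 (by decide); have a3 := hl' 3 (by decide)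
      have b1 := hk 0 3 (by decide) (by decide)
      simp only [Fin.reduceFinMk, Fin.isValue] at *
      omega
    · have a1 := hl' 0 (by decide); have a2 := hl' 1 (by decide); have a3 := hl' 2 (by decide)
      have b1 := hk 1 2 (by decide) (by decide)
      simp only [Fin.reduceFinMk, Fin.isValue] at *
      omega
  rcases key with ⟨k0, k1, k2, k3⟩ | ⟨k0, k1, k2, k3⟩
  · left; exact all4 k0 k1 k2 k3
  · right; exact all4 k0 k1 k2 k3

lemma orient_of_pt {n : ℕ} {ℬ : Finset (Finset (JJ n))}
    (hE : Exch (fun x : VV n => toS x ∈ ℬ)) (hB : ∀ C ∈ ℬ, ∃ x, toS x = C)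
    {t : VV n → ℤ} (ht : Pt ℬ t) : IsOrientation ℬ (sOf ℬ t) := by
  refine ⟨?_, ?_, ?_⟩
  · intro G A h
    rw [sOf, if_neg]
    rintro ⟨h1, h2⟩
    rcases h with h | h
    · exact h h1
    · exact h h2
  · intro G hG
    obtain ⟨F, rfl⟩ := hB G hG
    have htF := ht.one F hG
    refine ⟨?_, ?_, ?_, ?_, ?_⟩
    · intro A hA
      obtain ⟨A, rfl⟩ := hB A hA
      rw [sOf_toS t hG hA]
      apply sgn_cases
      linear_combination (t F * t F * kap F A * kap F A) * ht.one A hA + kap F A * kap F A * htF +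
        kap_sq F A
    · intro A B h hh
      obtain ⟨A, rfl⟩ := hB A h.1.1
      obtain ⟨B, rfl⟩ := hB B h.1.2.1
      rw [long_iff hE hB] at h
      obtain ⟨hA, hB', i, j, hij, rfl, hn⟩ := h
      rw [heightF_toS, heightF_toS] at hh
      rw [sOf_toS t hG hA, sOf_toS t hG hB', ← ht.long A i j hij hA hB' hn]
      rcases kap_two F A hij with ⟨_, h⟩ | ⟨h, _⟩
      · have := kap_sq F A
        linear_combination t A * t F * (kap F (A + ee i + ee j) * this - kap F A * h)
      · exact absurd hh h
    · intro A B h hh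
      obtain ⟨A, rfl⟩ := hB A h.1.1
      obtain ⟨B, rfl⟩ := hB B h.1.2.1
      rw [long_iff hE hB] at h
      obtain ⟨hA, hB', i, j, hij, rfl, hn⟩ := h
      rw [heightF_toS, heightF_toS] at hh
      rw [sOf_toS t hG hA, sOf_toS t hG hB', ← ht.long A i j hij hA hB' hn]
      rcases kap_two F A hij with ⟨h, _⟩ | ⟨_, h⟩
      · exact absurd h hh
      · have := kap_sq F A
        linear_combination t A * t F * (- kap F (A + ee i + ee j) * this + kap F A * h)
    · rintro v ⟨A, i, j, hij, h0, h1, h2, h3, hv⟩ k ⟨hk1, l, hlk, hl⟩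
      have b0 := hv 0; have b1 := hv 1; have b2 := hv 2; have b3 := hv 3
      rw [h0] at b0; rw [h1] at b1; rw [h2] at b2; rw [h3] at b3
      obtain ⟨A, rfl⟩ := hB A b0
      rw [toS_flip] at h1 h2 b1 b2
      rw [toS_flip2 _ _ _ hij] at h3 b3
      obtain ⟨i, ci⟩ := i
      obtain ⟨j, cj⟩ := j
      simp only at h1 h2 h3 b1 b2 b3 hij
      have hsq := ht.sq A i j hij b0 b1 b2 b3
      have s0 : sOf ℬ t (toS F) (v 0) = t A * t F * kap F A := by rw [h0]; exact sOf_toS t hG b0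
      have s1 : sOf ℬ t (toS F) (v 1) = t (A + ee i) * t F * kap F (A + ee i) := by rw [h1]; exact sOf_toS t hG b1
      have s2 : sOf ℬ t (toS F) (v 2) = t (A + ee j) * t F * kap F (A + ee j) := by rw [h2]; exact sOf_toS t hG b2
      have s3 : sOf ℬ t (toS F) (v 3) = t (A + ee i + ee j) * t F * kap F (A + ee i + ee j) := by rw [h3]; exact sOf_toS t hG b3
      have g0 : heightF (toS F) (v 0) = dd F A := by rw [h0]; exact heightF_toS F A
      have g1 : heightF (toS F) (v 1) = dd F (A + ee i) := by rw [h1]; exact heightF_toS F _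
      have g2 : heightF (toS F) (v 2) = dd F (A + ee j) := by rw [h2]; exact heightF_toS F _
      have g3 : heightF (toS F) (v 3) = dd F (A + ee i + ee j) := by rw [h3]; exact heightF_toS F _
      have k1 := kap_two F A hij
      have k2 := kap_two F (A + ee i) hij
      rw [ee_cancel] at k2
      have t0 := ht.one A b0
      have t1 := ht.one _ b1
      have t2 := ht.one _ b2
      have t3 := ht.one _ b3
      have c0 := kap_sq F A
      have c1 := kap_sq F (A + ee i)
      have c2 := kap_sq F (A + ee j)
      have c3 := kap_sq F (A + ee i + ee j)
      have sone : ∀ l, sOf ℬ t (toS F) (v l) = 1 ∨ sOf ℬ t (toS F) (v l) = -1 := by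
        intro l
        obtain ⟨y, hy⟩ := hB _ (hv l)
        have hy' := hv l
        rw [← hy] at hy' ⊢
        rw [sOf_toS t hG hy']
        apply sgn_cases
        linear_combination (t F * t F * kap F y * kap F y) * ht.one y hy' +
          kap F y * kap F y * htF + kap_sq F y
      have hj : (A + ee i) j = A j := ee_ne _ hij.symm
      have hji : (A + ee j) i = A i := ee_ne _ hij
      have hcomm : A + ee j + ee i = A + ee i + ee j := by abel
      have hcomm2 : A + ee i + ee j + ee i = A + ee j := by
        rw [← hcomm, ee_cancel]
      have p03 : sOf ℬ t (toS F) (v 0) * sOf ℬ t (toS F) (v 3) =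
          t A * t (A + ee i + ee j) * (kap F A * kap F (A + ee i + ee j)) := by
        rw [s0, s3]
        linear_combination (t A * t (A + ee i + ee j) * (kap F A * kap F (A + ee i + ee j))) * htF
      have p12 : sOf ℬ t (toS F) (v 1) * sOf ℬ t (toS F) (v 2) =
          t (A + ee i) * t (A + ee j) * (kap F (A + ee i) * kap F (A + ee j)) := by
        rw [s1, s2]
        linear_combination (t (A + ee i) * t (A + ee j) * (kap F (A + ee i) * kap F (A + ee j))) * htF
      have e4 : A + ee i + ee i + ee j = A + ee j := by rw [ee_cancel]
      have n03 : ∀ l m, sOf ℬ t (toS F) (v l) * sOf ℬ t (toS F) (v m) = 1 →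
          sOf ℬ t (toS F) (v l) = sOf ℬ t (toS F) (v m) := by
        intro l m h
        rcases sone l with h1 | h1 <;> rcases sone m with h2 | h2 <;> rw [h1, h2] at h ⊢ <;>
          norm_num at h
      have m03 : ∀ l m, sOf ℬ t (toS F) (v l) * sOf ℬ t (toS F) (v m) = -1 →
          sOf ℬ t (toS F) (v l) ≠ sOf ℬ t (toS F) (v m) := by
        intro l m h e
        rw [e] at h
        rcases sone m with h2 | h2 <;> rw [h2] at h <;> norm_num at h
      refine sq_comb (fun l => sOf ℬ t (toS F) (v l)) (fun l => heightF (toS F) (v l)) k sone ?_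
        hk1 ⟨l, hlk, hl⟩
      simp only [g0, g1, g2, g3]
      by_cases hFi : F i = A i <;> by_cases hFj : F j = A j
      · left
        have d1 := dd_up hFi
        have d2 := dd_up hFj
        have d3 := dd_up (hFj.trans hj.symm)
        refine ⟨by omega, by omega, ?_⟩
        rcases k1 with ⟨k1, _⟩ | ⟨_, k1⟩
        · omega
        rcases k2 with ⟨_, k2⟩ | ⟨k2, _⟩
        · rcases hsq with h | h
          · left; apply m03; rw [p03, k1, ← h, t0]; rfl
          · right; apply n03; rw [p12, k2, ← h, t1]; rfl
        · omega
      · right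
        have hFj' : F j ≠ (A + ee i) j := by rw [hj]; exact hFj
        have d1 := dd_up hFi
        have d2 := dd_down hFj
        have d3 := dd_down hFj'
        refine ⟨by omega, by omega, ?_⟩
        rcases k1 with ⟨_, k1⟩ | ⟨k1, _⟩
        · rcases k2 with ⟨k2, _⟩ | ⟨_, k2⟩
          · omega
          rcases hsq with h | h
          · left; apply n03; rw [p03, k1, ← h, t0]; rfl
          · right; apply m03; rw [p12, k2, ← h, t1]; rfl
        · omega
      · right
        have d1 := dd_down hFi
        have d2 := dd_up hFj
        have d3 := dd_up (hFj.trans hj.symm)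
        refine ⟨by omega, by omega, ?_⟩
        rcases k1 with ⟨_, k1⟩ | ⟨k1, _⟩
        · rcases k2 with ⟨k2, _⟩ | ⟨_, k2⟩
          · omega
          rcases hsq with h | h
          · left; apply n03; rw [p03, k1, ← h, t0]; rfl
          · right; apply m03; rw [p12, k2, ← h, t1]; rfl
        · omega
      · left
        have hFj' : F j ≠ (A + ee i) j := by rw [hj]; exact hFj
        have d1 := dd_down hFi
        have d2 := dd_down hFj
        have d3 := dd_down hFj'
        refine ⟨by omega, by omega, ?_⟩
        rcases k1 with ⟨k1, _⟩ | ⟨_, k1⟩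
        · omega
        rcases k2 with ⟨_, k2⟩ | ⟨k2, _⟩
        · rcases hsq with h | h
          · left; apply m03; rw [p03, k1, ← h, t0]; rfl
          · right; apply n03; rw [p12, k2, ← h, t1]; rfl
        · omega
    · rw [sOf_toS t hG hG, kap_self, htF]; rfl
  · intro G hG H hH A hA
    obtain ⟨G, rfl⟩ := hB G hG
    obtain ⟨H, rfl⟩ := hB H hH
    obtain ⟨A, rfl⟩ := hB A hA
    rw [sOf_toS t hG hA, sOf_toS t hH hA, sOf_toS t hH hG, card_third, kap_cocycle G H A]
    linear_combination (-(t A * t G * (kap H A * kap H G * (-1) ^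
      (Finset.univ.filter fun k => G k ≠ H k ∧ G k ≠ A k).card))) * ht.one H hH


lemma pt_of_orient {n : ℕ} {ℬ : Finset (Finset (JJ n))}
    (hE : Exch (fun x : VV n => toS x ∈ ℬ)) (hB : ∀ C ∈ ℬ, ∃ x, toS x = C)
    {s : Finset (JJ n) → Finset (JJ n) → ℤ} (hs : IsOrientation ℬ s) {F : VV n}
    (hF : toS F ∈ ℬ) : ∃ t, Pt ℬ t ∧ ∀ G A, toS G ∈ ℬ → toS A ∈ ℬ →
      s (toS G) (toS A) = t A * t G * kap G A := by
  obtain ⟨-, hs2, hs3⟩ := hs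
  have hone : ∀ G A, toS G ∈ ℬ → toS A ∈ ℬ → s (toS G) (toS A) * s (toS G) (toS A) = 1 := by
    intro G A hG hA
    rcases (hs2 _ hG).1 _ hA with h | h <;> rw [h] <;> norm_num
  set t : VV n → ℤ := fun A => s (toS F) (toS A) * kap F A with htdef
  have t1 : ∀ A, toS A ∈ ℬ → t A * t A = 1 := by
    intro A hA
    simp only [htdef]
    linear_combination kap F A * kap F A * hone F A hF hA + kap_sq F A
  have hst : ∀ G A, toS G ∈ ℬ → toS A ∈ ℬ → s (toS G) (toS A) = t A * t G * kap G A := by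
    intro G A hG hA
    have h := hs3 _ hG _ hF _ hA
    rw [card_third] at h
    rw [h]
    simp only [htdef]
    rw [kap_cocycle G F A]
    have e1 := kap_sq F A
    have e2 := kap_sq F G
    set q : ℤ := (-1) ^ (Finset.univ.filter fun k => G k ≠ F k ∧ G k ≠ A k).card
    linear_combination (-(s (toS F) (toS A) * s (toS F) (toS G) * q)) *
      (kap F G * kap F G * e1 + e2)
  refine ⟨t, ⟨t1, ?_, ?_⟩, hst⟩
  · intro A i j hij hA hA' hn
    have hl : IsLongEdge ℬ (toS A) (toS (A + ee i + ee j)) :=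
      (long_iff hE hB).mpr ⟨hA, hA', i, j, hij, rfl, hn⟩
    have o := hs2 _ hF
    simp only [htdef]
    have q := kap_sq F (A + ee i + ee j)
    rcases kap_two F A hij with ⟨h, h'⟩ | ⟨h, h'⟩
    · rw [o.2.1 _ _ hl (by rw [heightF_toS, heightF_toS]; exact h)]
      linear_combination s (toS F) (toS (A + ee i + ee j)) *
        (kap F (A + ee i + ee j) * h' - kap F A * q)
    · rw [o.2.2.1 _ _ hl (by rw [heightF_toS, heightF_toS]; exact h)]
      linear_combination s (toS F) (toS (A + ee i + ee j)) *
        (- kap F (A + ee i + ee j) * h' + kap F A * q)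
  · intro A i j hij h0 h1 h2 h3
    by_contra hcon
    push Not at hcon
    have o := (hs2 _ h0).2.2.2.1
    set v : Fin 4 → Finset (JJ n) := ![toS A, toS (A + ee i), toS (A + ee j), toS (A + ee i + ee j)]
      with hv
    have v0 : v 0 = toS A := rfl
    have v1 : v 1 = toS (A + ee i) := rfl
    have v2 : v 2 = toS (A + ee j) := rfl
    have v3 : v 3 = toS (A + ee i + ee j) := rfl
    have hsq : ShortSquare ℬ v := by
      refine ⟨toS A, (i, true), (j, true), hij, rfl, ?_, ?_, ?_, ?_⟩
      · rw [toS_flip]; exact v1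
      · rw [toS_flip]; exact v2
      · rw [toS_flip2 _ _ _ hij]; exact v3
      · exact all4 h0 h1 h2 h3
    have s0 := hst A A h0 h0
    have s1 := hst A _ h0 h1
    have s2 := hst A _ h0 h2
    have s3 := hst A _ h0 h3
    rw [kap_self] at s0
    rw [kap_one] at s1 s2
    have hj : A j = (A + ee i) j := (ee_ne _ hij.symm).symm
    have kk : kap A (A + ee i + ee j) = -1 := by
      have := kap_up hj
      rw [kap_one, pp_flip] at this
      have p := pp_sq A
      linear_combination pp A * this - (kap A (A + ee i + ee j) + 1) * p
    rw [kk] at s3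
    have d0 := dd_self A
    have d1 : dd A (A + ee i) = _ := dd_up rfl
    have d2 : dd A (A + ee j) = _ := dd_up rfl
    have d3 := dd_up hj
    rw [d0] at d1 d2
    rw [d1] at d3
    have hp := sgn_cases (pp_sq A)
    have q0 := sgn_cases (t1 A h0)
    have q1 := sgn_cases (t1 _ h1)
    have q2 := sgn_cases (t1 _ h2)
    have q3 := sgn_cases (t1 _ h3)
    have w0 : s (toS A) (toS A) = 1 := by rw [s0, t1 A h0]; rfl
    have w3 : s (toS A) (toS (A + ee i + ee j)) = 1 := by
      rw [s3]
      have : t (A + ee i + ee j) = - t A := by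
        have := hcon.1
        omega
      rw [this]; linear_combination t1 A h0
    have w12 : s (toS A) (toS (A + ee i)) = - s (toS A) (toS (A + ee j)) := by
      rw [s1, s2]
      have : t (A + ee i) = - t (A + ee j) := by
        have := hcon.2
        omega
      rw [this]; ring
    have w1 := (hs2 _ h0).1 _ h1
    have hh : ∀ l, heightF (toS A) (v l) = ![0, 1, 1, 2] l := by
      apply all4
      · rw [v0, heightF_toS, d0]; rfl
      · rw [v1, heightF_toS, d1]; rfl
      · rw [v2, heightF_toS, d2]; rfl
      · rw [v3, heightF_toS, d3]; rfl
    rcases w1 with w1 | w1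
    · have := o v hsq 2 ⟨?_, 1, by decide, ?_⟩
      · rcases this with h | h
        · have := h 3; rw [hh, hh] at this; revert this; decide
        · have := h 0; rw [hh, hh] at this; revert this; decide
      · apply all4 <;> apply all4 <;> intro a c <;>
          first
          | exact absurd rfl a
          | exact absurd rfl c
          | (simp only [v0, v1, v3, w0, w1, w3])
      · rw [v1, v2, w12]; omega
    · have := o v hsq 1 ⟨?_, 2, by decide, ?_⟩
      · rcases this with h | h
        · have := h 3; rw [hh, hh] at this; revert this; decide
        · have := h 0; rw [hh, hh] at this; revert this; decide
      · have w2 : s (toS A) (toS (A + ee j)) = 1 := by omega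
        apply all4 <;> apply all4 <;> intro a c <;>
          first
          | exact absurd rfl a
          | exact absurd rfl c
          | (simp only [v0, v2, v3, w0, w2, w3])
      · rw [v1, v2, w12]; omega

lemma induced_of {n : ℕ} {ℬ : Finset (Finset (JJ n))}
    (hE : Exch (fun x : VV n => toS x ∈ ℬ)) (hB : ∀ C ∈ ℬ, ∃ x, toS x = C)
    {t : VV n → ℤ} (ht : Pt ℬ t) {s ε : Finset (JJ n) → Finset (JJ n) → ℤ}
    (hs : ∀ G A, toS G ∈ ℬ → toS A ∈ ℬ → s (toS G) (toS A) = t A * t G * kap G A)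
    (hε : ∀ A i, toS A ∈ ℬ → toS (A + ee i) ∈ ℬ →
      ε (toS A) (toS (A + ee i)) = t A * t (A + ee i) * pp A) : InducedBy ℬ ε s := by
  intro F hF
  obtain ⟨F, rfl⟩ := hB F hF
  have hFF := ht.one F hF
  refine ⟨by rw [hs F F hF hF, kap_self, hFF]; rfl, ?_⟩
  intro A B hAB
  obtain ⟨A, rfl⟩ := hB A hAB.1
  obtain ⟨B, rfl⟩ := hB B hAB.2.1
  have hA := hAB.1
  have hB' := hAB.2.1
  have sA : s (toS F) (toS A) = 1 ∨ s (toS F) (toS A) = -1 := by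
    apply sgn_cases; rw [hs F A hF hA]
    linear_combination (t F * t F * kap F A * kap F A) * ht.one A hA + kap F A * kap F A * hFF +
        kap_sq F A
  have sB : s (toS F) (toS B) = 1 ∨ s (toS F) (toS B) = -1 := by
    apply sgn_cases; rw [hs F B hF hB']
    linear_combination (t F * t F * kap F B * kap F B) * ht.one B hB' + kap F B * kap F B * hFF +
        kap_sq F B
  have prod : s (toS F) (toS A) * s (toS F) (toS B) = t A * t B * (kap F A * kap F B) := by
    rw [hs F A hF hA, hs F B hF hB']
    linear_combination (t A * t B * (kap F A * kap F B)) * hFF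
  have eqof : s (toS F) (toS A) * s (toS F) (toS B) = 1 → s (toS F) (toS A) = s (toS F) (toS B) := by
    intro h
    rcases sA with h1 | h1 <;> rcases sB with h2 | h2 <;> rw [h1, h2] at h ⊢ <;> norm_num at h
  have neof : s (toS F) (toS A) * s (toS F) (toS B) = -1 →
      s (toS F) (toS A) = - s (toS F) (toS B) := by
    intro h
    rcases sA with h1 | h1 <;> rcases sB with h2 | h2 <;> rw [h1, h2] at h <;>
      omega
  rcases edge_cases hE hAB with ⟨i, rfl⟩ | ⟨i, j, hij, rfl, hn⟩
  · have e1 := hε A i hA hB'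
    have e2' := hε (A + ee i) i hB' (by rw [ee_cancel]; exact hA)
    rw [ee_cancel, pp_flip] at e2'
    have hsh : IsShortEdge ℬ (toS A) (toS (A + ee i)) := (short_iff hB).mpr ⟨hA, hB', i, rfl⟩
    have hnl : ¬ IsLongEdge ℬ (toS A) (toS (A + ee i)) := by
      intro h
      obtain ⟨-, -, k, l, hkl, e, -⟩ := (long_iff hE hB).mp h
      exact e_two_ne_one hkl e.symm
    have eone : ε (toS A) (toS (A + ee i)) = 1 ∨ ε (toS A) (toS (A + ee i)) = -1 := by
      apply sgn_cases; rw [e1]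
      linear_combination (t (A + ee i) * t (A + ee i) * pp A * pp A) * ht.one A hA +
        pp A * pp A * ht.one _ hB' + pp_sq A
    have e3 : ε (toS (A + ee i)) (toS A) = - ε (toS A) (toS (A + ee i)) := by
      rw [e1, e2']; ring
    unfold IsInducingEdge
    rw [heightF_toS, heightF_toS]
    by_cases h : F i = A i
    · have d := dd_up h
      have k := kap_up h
      rw [k] at prod
      have prod' : s (toS F) (toS A) * s (toS F) (toS (A + ee i)) = ε (toS A) (toS (A + ee i)) := by
        rw [prod, e1]
      constructor
      · rintro (⟨h1, -⟩ | ⟨-, ⟨h1, -⟩ | ⟨h1, h2⟩⟩)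
        · exact absurd h1 hnl
        · omega
        · apply neof; rw [prod']; omega
      · intro hne
        apply eqof; rw [prod']
        rcases eone with h1 | h1
        · exact h1
        · exact absurd (Or.inr ⟨hsh, Or.inr ⟨by omega, by omega⟩⟩) hne
    · have d := dd_down h
      have k := kap_down h
      rw [k] at prod
      have prod' : s (toS F) (toS A) * s (toS F) (toS (A + ee i)) =
          - ε (toS A) (toS (A + ee i)) := by
        rw [prod, e1]; ring
      constructor
      · rintro (⟨h1, -⟩ | ⟨-, ⟨h1, h2⟩ | ⟨h1, h2⟩⟩)
        · exact absurd h1 hnl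
        · apply neof; rw [prod']; omega
        · omega
      · intro hne
        apply eqof; rw [prod']
        rcases eone with h1 | h1
        · exact absurd (Or.inr ⟨hsh, Or.inl ⟨by omega, by omega⟩⟩) hne
        · rw [h1]; norm_num
  · have hlo : IsLongEdge ℬ (toS A) (toS (A + ee i + ee j)) :=
      (long_iff hE hB).mpr ⟨hA, hB', i, j, hij, rfl, hn⟩
    have hns : ¬ IsShortEdge ℬ (toS A) (toS (A + ee i + ee j)) := by
      intro h
      obtain ⟨-, -, k, e⟩ := (short_iff hB).mp h
      exact e_two_ne_one hij e
    have ht' := ht.long A i j hij hA hB' hn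
    rw [← ht', ht.one A hA, one_mul] at prod
    unfold IsInducingEdge
    rw [heightF_toS, heightF_toS]
    rcases kap_two F A hij with ⟨h, h'⟩ | ⟨h, h'⟩
    · rw [h'] at prod
      constructor
      · rintro (⟨-, h1⟩ | ⟨h1, -⟩)
        · exact absurd h h1
        · exact absurd h1 hns
      · intro _; exact eqof prod
    · rw [h'] at prod
      constructor
      · intro _; exact neof prod
      · intro hne; exact absurd (Or.inl ⟨hlo, h⟩) hne

lemma eps_unique {n : ℕ} {ℬ : Finset (Finset (JJ n))}
    (hE : Exch (fun x : VV n => toS x ∈ ℬ)) (hB : ∀ C ∈ ℬ, ∃ x, toS x = C)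
    {s ε : Finset (JJ n) → Finset (JJ n) → ℤ}
    (hε : IsPolytopeOrientation ℬ ε) (hi : InducedBy ℬ ε s) {A : VV n} {i : Fin n}
    (hA : toS A ∈ ℬ) (hA' : toS (A + ee i) ∈ ℬ) :
    ε (toS A) (toS (A + ee i)) = s (toS A) (toS (A + ee i)) := by
  have hsh : IsShortEdge ℬ (toS A) (toS (A + ee i)) := (short_iff hB).mpr ⟨hA, hA', i, rfl⟩
  obtain ⟨h1, h2⟩ := hi _ hA
  obtain ⟨h3, h4⟩ := h2 _ _ hsh.1
  obtain ⟨e1, e3⟩ := hε.1 _ _ hsh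
  have d : dd A (A + ee i) = _ := dd_up rfl
  rw [dd_self] at d
  have hnl : ¬ IsLongEdge ℬ (toS A) (toS (A + ee i)) := by
    intro h
    obtain ⟨-, -, k, l, hkl, e, -⟩ := (long_iff hE hB).mp h
    exact e_two_ne_one hkl e.symm
  rcases e1 with e1 | e1
  · rw [← h4, h1, e1]
    unfold IsInducingEdge
    rw [heightF_toS, heightF_toS, dd_self, d]
    rintro (⟨h1, -⟩ | ⟨-, ⟨h1, h2⟩ | ⟨h1, h2⟩⟩)
    · exact absurd h1 hnl
    · omega
    · omega
  · have := h3 (Or.inr ⟨hsh, Or.inr ⟨?_, ?_⟩⟩)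
    · omega
    · rw [heightF_toS, heightF_toS, dd_self, d]; omega
    · rw [e3, e1]; norm_num

lemma s_unique {n : ℕ} {ℬ : Finset (Finset (JJ n))}
    (hE : Exch (fun x : VV n => toS x ∈ ℬ)) (hB : ∀ C ∈ ℬ, ∃ x, toS x = C)
    {s s' ε : Finset (JJ n) → Finset (JJ n) → ℤ}
    (h1 : InducedBy ℬ ε s) (h2 : InducedBy ℬ ε s') {G A : VV n}
    (hG : toS G ∈ ℬ) (hA : toS A ∈ ℬ) : s (toS G) (toS A) = s' (toS G) (toS A) := by
  have step : ∀ C D, IsEdge ℬ C D → s (toS G) D = s' (toS G) D → s (toS G) C = s' (toS G) C := by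
    intro C D hCD h
    obtain ⟨a1, a2⟩ := (h1 _ hG).2 _ _ hCD
    obtain ⟨c1, c2⟩ := (h2 _ hG).2 _ _ hCD
    by_cases hi : IsInducingEdge ℬ ε (toS G) C D
    · rw [a1 hi, c1 hi, h]
    · rw [a2 hi, c2 hi, h]
  refine path_ind hE (fun X => s (toS G) (toS X) = s' (toS G) (toS X)) G hG ?_ (fun _ => True)
    ?_ ?_ _ A hA rfl (fun _ _ => trivial)
  · show s (toS G) (toS G) = s' (toS G) (toS G)
    rw [(h1 _ hG).1, (h2 _ hG).1]
  · intro X i _ _ hX hX' hq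
    exact step _ _ (edge_short hX hX' hB) hq
  · intro X i j hij _ _ hX hX' hn hq
    exact step _ _ (edge_long hij hX hX' hB hn) hq


/-! ### Cyclic sums over two-dimensional faces -/

lemma sg_sub_ne {a c : ZMod 2} (h : a ≠ c) : sg c - sg a ≠ 0 := by
  intro e
  exact h (sg_inj (by linarith))

lemma classes {n : ℕ} (W : Submodule ℝ (Fin n → ℝ)) (hW : Module.finrank ℝ W = 2) {i : Fin n}
    (hi : (Pi.single i 1 : Fin n → ℝ) ∈ W) {A B C : VV n}
    (hAB : eSet (toS B) - eSet (toS A) ∈ W) (hAC : eSet (toS C) - eSet (toS A) ∈ W)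
    (h1 : ∃ k, k ≠ i ∧ A k ≠ B k) (h2 : ∃ k, k ≠ i ∧ A k ≠ C k)
    (h3 : ∃ k, k ≠ i ∧ B k ≠ C k) : False := by
  set f : Fin 3 → (Fin n → ℝ) := ![Pi.single i 1, eSet (toS B) - eSet (toS A),
    eSet (toS C) - eSet (toS A)] with hf
  have hind : LinearIndependent ℝ f := by
    rw [Fintype.linearIndependent_iff]
    intro g hg
    rw [Fin.sum_univ_three] at hg
    have hco : ∀ k, g 0 * (if k = i then 1 else 0) + g 1 * (sg (B k) - sg (A k)) +
        g 2 * (sg (C k) - sg (A k)) = 0 := by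
      intro k
      have := congrFun hg k
      simpa [hf, Pi.single_apply, eSet_toS] using this
    have hco' : ∀ k, k ≠ i → g 1 * (sg (B k) - sg (A k)) + g 2 * (sg (C k) - sg (A k)) = 0 := by
      intro k hk
      have := hco k
      simpa [hk] using this
    obtain ⟨k1, hk1, hA1⟩ := h1
    obtain ⟨k2, hk2, hA2⟩ := h2
    obtain ⟨k3, hk3, hA3⟩ := h3
    have e1 := hco' k1 hk1
    have e2 := hco' k2 hk2
    have e3 := hco' k3 hk3
    have hz : g 1 = 0 ∧ g 2 = 0 := by
      by_cases h : A k3 = B k3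
      · have h' : A k3 ≠ C k3 := h ▸ hA3
        rw [h, sub_self, mul_zero, zero_add, ← h] at e3
        have g2 : g 2 = 0 := (mul_eq_zero.mp e3).resolve_right (sg_sub_ne h')
        rw [g2, zero_mul, add_zero] at e1
        exact ⟨(mul_eq_zero.mp e1).resolve_right (sg_sub_ne hA1), g2⟩
      · have h' : A k3 = C k3 := by
          by_contra hne
          exact hA3 ((z2_one h).symm.trans (z2_one hne))
        rw [← h', sub_self, mul_zero, add_zero] at e3
        have g1 : g 1 = 0 := (mul_eq_zero.mp e3).resolve_right (sg_sub_ne h)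
        rw [g1, zero_mul, zero_add] at e2
        exact ⟨g1, (mul_eq_zero.mp e2).resolve_right (sg_sub_ne hA2)⟩
    have e0 := hco i
    rw [hz.1, hz.2] at e0
    simp at e0
    intro l
    fin_cases l
    · exact e0
    · exact hz.1
    · exact hz.2
  have hsub : Submodule.span ℝ (Set.range f) ≤ W := by
    rw [Submodule.span_le]
    rintro _ ⟨l, rfl⟩
    fin_cases l
    · exact hi
    · exact hAB
    · exact hAC
  have := Submodule.finrank_mono hsub
  rw [finrank_span_eq_card hind, hW] at this
  simp at this

lemma face_le_four {n : ℕ} {ℬ : Finset (Finset (JJ n))} {Fc : Set (Fin n → ℝ)} {m : ℕ}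
    {x : ℕ → VV n} (h : FaceCycle ℬ Fc m (fun k => toS (x k))) {a : ℕ} (ha : a < m) {i : Fin n}
    (hi : x ((a + 1) % m) = x a + ee i) : m ≤ 4 := by
  obtain ⟨⟨-, hfin⟩, h3, hmem, hex, -⟩ := h
  have hinj : ∀ k l, k < m → l < m → x k = x l → k = l := by
    intro k l hk hl e
    obtain ⟨j, hj, hj'⟩ := hex (toS (x k)) (hmem k hk).1 (hmem k hk).2
    rw [hj' k ⟨hk, rfl⟩, hj' l ⟨hl, by rw [e]⟩]
  have hW : ∀ k l, k < m → l < m → eSet (toS (x k)) - eSet (toS (x l)) ∈ vectorSpan ℝ Fc :=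
    fun k l hk hl => vsub_mem_vectorSpan ℝ (hmem k hk).2 (hmem l hl).2
  have hi' : (Pi.single i 1 : Fin n → ℝ) ∈ vectorSpan ℝ Fc := by
    have h1 := hW a ((a + 1) % m) ha (Nat.mod_lt _ (by omega))
    have h2 := Submodule.smul_mem _ (sg (x a i) / 2) h1
    convert h2 using 1
    ext k
    simp only [Pi.smul_apply, Pi.sub_apply, eSet_toS, smul_eq_mul, Pi.single_apply, hi]
    by_cases hk : k = i
    · subst hk
      rw [if_pos rfl, ee_self, sg_flip]
      have := sg_sq (x a k)
      linarith
    · rw [if_neg hk, ee_ne _ hk]; ring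
  have hcl : ∀ k l, k < m → l < m → x k i = x l i →
      ((∀ j, j ≠ i → x a j = x k j) ↔ (∀ j, j ≠ i → x a j = x l j)) → k = l := by
    intro k l hk hl hki hiff
    apply hinj k l hk hl
    have key : ∀ j, j ≠ i → x k j = x l j := by
      by_cases hc : ∀ j, j ≠ i → x a j = x k j
      · have hc' := hiff.mp hc
        intro j hj; rw [← hc j hj, hc' j hj]
      · have hc' : ¬ ∀ j, j ≠ i → x a j = x l j := fun h => hc (hiff.mpr h)
        by_contra hcon
        push Not at hc hc' hcon
        exact classes _ hfin hi' (hW k a hk ha) (hW l a hl ha) hc hc' hcon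
    ext j
    by_cases hj : j = i
    · rw [hj, hki]
    · exact key j hj
  have hle : (Finset.range m).card ≤ (Finset.univ : Finset (ZMod 2 × Bool)).card := by
    apply Finset.card_le_card_of_injOn
      (fun k => (x k i, decide (∀ j, j ≠ i → x a j = x k j)))
    · intro _ _; simp
    · intro k hk l hl e
      simp only [Finset.coe_range, Set.mem_Iio, Prod.mk.injEq, decide_eq_decide] at hk hl e
      exact hcl k l hk hl e.1 e.2
  rw [Finset.card_range] at hle
  refine hle.trans (le_of_eq ?_)
  rw [Finset.card_univ, Fintype.card_prod, ZMod.card, Fintype.card_bool]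

lemma cyc3 {a b c p q r : ℤ} (hp : p * p = 1) (h0 : (p = q ∧ a = b) ∨ q = -p)
    (h1 : (q = r ∧ b = c) ∨ r = -q) (h2 : (r = p ∧ c = a) ∨ p = -r) :
    a * b * (p - q) + b * c * (q - r) + c * a * (r - p) = 0 := by
  rcases h0 with ⟨p0, q0⟩ | p0
  · rw [p0, q0]; ring
  rcases h1 with ⟨p1, q1⟩ | p1
  · rw [p1, q1]; ring
  rcases h2 with ⟨p2, q2⟩ | p2
  · rw [p2, q2]; ring
  have h : p = 0 := by omega
  rw [h] at hp
  norm_num at hp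

lemma poly_of_pt {n : ℕ} {ℬ : Finset (Finset (JJ n))}
    (hE : Exch (fun x : VV n => toS x ∈ ℬ)) (hB : ∀ C ∈ ℬ, ∃ x, toS x = C)
    {t : VV n → ℤ} (ht : Pt ℬ t) {ε : Finset (JJ n) → Finset (JJ n) → ℤ}
    (hε : ∀ A i, toS A ∈ ℬ → toS (A + ee i) ∈ ℬ →
      ε (toS A) (toS (A + ee i)) = t A * t (A + ee i) * pp A)
    (h0 : ∀ A B, ¬ IsShortEdge ℬ A B → ε A B = 0) : IsPolytopeOrientation ℬ ε := by
  refine ⟨?_, h0, ?_⟩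
  · intro A B h
    obtain ⟨A, rfl⟩ := hB A h.1.1
    obtain ⟨B, rfl⟩ := hB B h.1.2.1
    obtain ⟨hA, hB', i, rfl⟩ := (short_iff hB).mp h
    have e1 := hε A i hA hB'
    have e2' := hε (A + ee i) i hB' (by rw [ee_cancel]; exact hA)
    rw [ee_cancel, pp_flip] at e2'
    constructor
    · apply sgn_cases; rw [e1]
      linear_combination (t (A + ee i) * t (A + ee i) * pp A * pp A) * ht.one A hA +
        pp A * pp A * ht.one _ hB' + pp_sq A
    · rw [e1, e2']; ring
  intro Fc m v hv
  -- replace v by vectors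
  have hmem := hv.2.2.1
  have h3 := hv.2.1
  set x : ℕ → VV n := fun k => if k < m then chi (v k) else 0 with hx
  have hxv : ∀ k, k < m → toS (x k) = v k := by
    intro k hk
    obtain ⟨y, hy⟩ := hB _ (hmem k hk).1
    simp only [hx, if_pos hk]
    rw [← hy, chi_toS]
  have hmod : ∀ k, (k + 1) % m < m := fun k => Nat.mod_lt _ (by omega)
  have hv' : FaceCycle ℬ Fc m (fun k => toS (x k)) := by
    obtain ⟨a1, a2, a3, a4, a5⟩ := hv
    refine ⟨a1, a2, ?_, ?_, ?_⟩
    · intro i hi; simp only [hxv i hi]; exact a3 i hi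
    · intro A hA hA'
      obtain ⟨i, ⟨hi, hi'⟩, huniq⟩ := a4 A hA hA'
      refine ⟨i, ⟨hi, by simp only [hxv i hi]; exact hi'⟩, ?_⟩
      rintro j ⟨hj, hj'⟩
      exact huniq j ⟨hj, by simp only [hxv j hj] at hj'; exact hj'⟩
    · intro i hi; simp only [hxv i hi, hxv _ (hmod i)]; exact a5 i hi
  have hsum : (∑ i ∈ Finset.range m, ε (v i) (v ((i + 1) % m))) =
      ∑ i ∈ Finset.range m, ε (toS (x i)) (toS (x ((i + 1) % m))) := by
    refine Finset.sum_congr rfl fun k hk => ?_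
    rw [hxv k (Finset.mem_range.mp hk), hxv _ (hmod k)]
  rw [hsum]
  have hed := hv'.2.2.2.2
  have hbm : ∀ k, k < m → toS (x k) ∈ ℬ := fun k hk => (hv'.2.2.1 k hk).1
  have hinj : ∀ k l, k < m → l < m → x k = x l → k = l := by
    intro k l hk hl e
    obtain ⟨j, hj, hj'⟩ := hv'.2.2.2.1 (toS (x k)) (hbm k hk) (hv'.2.2.1 k hk).2
    rw [hj' k ⟨hk, rfl⟩, hj' l ⟨hl, by simp only [e]⟩]
  by_cases hex : ∃ a, a < m ∧ ∃ i, x ((a + 1) % m) = x a + ee i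
  · obtain ⟨a, ha, i, hi⟩ := hex
    have h4 := face_le_four hv' ha hi
    -- edge description
    have hstep : ∀ k l, IsEdge ℬ (toS (x k)) (toS (x l)) →
        (2 * ε (toS (x k)) (toS (x l)) = t (x k) * t (x l) * (pp (x k) - pp (x l))) ∧
        ((pp (x k) = pp (x l) ∧ t (x k) = t (x l)) ∨
          (pp (x l) = - pp (x k) ∧ ∃ i, x l = x k + ee i)) := by
      intro k l hkl
      rcases edge_cases hE hkl with ⟨i, hi⟩ | ⟨i, j, hij, hi, hn⟩
      · have hl := hkl.2.1
        rw [hi] at hl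
        rw [hi, hε _ i hkl.1 hl, pp_flip]
        exact ⟨by ring, Or.inr ⟨rfl, i, rfl⟩⟩
      · have hl := hkl.2.1
        rw [hi] at hl
        have e : pp (x k + ee i + ee j) = pp (x k) := by rw [pp_flip, pp_flip, neg_neg]
        have hns : ¬ IsShortEdge ℬ (toS (x k)) (toS (x l)) := by
          intro h
          obtain ⟨-, -, q, e⟩ := (short_iff hB).mp h
          exact e_two_ne_one hij (hi.symm.trans e)
        rw [h0 _ _ hns, hi, e]
        exact ⟨by ring, Or.inl ⟨rfl, ht.long _ i j hij hkl.1 hl hn⟩⟩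
    have h34 : m = 3 ∨ m = 4 := by omega
    rcases h34 with rfl | rfl
    · obtain ⟨s0, c0⟩ := hstep 0 1 (hed 0 (by norm_num))
      obtain ⟨s1, c1⟩ := hstep 1 2 (hed 1 (by norm_num))
      obtain ⟨s2, c2⟩ := hstep 2 0 (hed 2 (by norm_num))
      have : (∑ i ∈ Finset.range 3, ε (toS (x i)) (toS (x ((i + 1) % 3)))) =
        ε (toS (x 0)) (toS (x 1)) + ε (toS (x 1)) (toS (x 2)) + ε (toS (x 2)) (toS (x 0)) := by
        simp [Finset.sum_range_succ]
      rw [this]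
      suffices hh : 2 * (ε (toS (x 0)) (toS (x 1)) + ε (toS (x 1)) (toS (x 2)) +
          ε (toS (x 2)) (toS (x 0))) = 0 by omega
      rw [mul_add, mul_add, s0, s1, s2]
      rcases c0 with ⟨p, q⟩ | ⟨p, -⟩
      · rw [p, q]; ring
      · rcases c1 with ⟨p', q⟩ | ⟨p', -⟩
        · rw [p', q]; ring
        · rcases c2 with ⟨p'', q⟩ | ⟨p'', -⟩
          · rw [p'', q]; ring
          · have := pp_sq (x 0)
            have h0 : pp (x 0) = 0 := by omega
            rw [h0] at this; norm_num at this
    · obtain ⟨s0, c0⟩ := hstep 0 1 (hed 0 (by norm_num))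
      obtain ⟨s1, c1⟩ := hstep 1 2 (hed 1 (by norm_num))
      obtain ⟨s2, c2⟩ := hstep 2 3 (hed 2 (by norm_num))
      obtain ⟨s3, c3⟩ := hstep 3 0 (hed 3 (by norm_num))
      have : (∑ i ∈ Finset.range 4, ε (toS (x i)) (toS (x ((i + 1) % 4)))) =
        ε (toS (x 0)) (toS (x 1)) + ε (toS (x 1)) (toS (x 2)) + ε (toS (x 2)) (toS (x 3)) +
          ε (toS (x 3)) (toS (x 0)) := by
        simp [Finset.sum_range_succ]
      rw [this]
      suffices hh : 2 * (ε (toS (x 0)) (toS (x 1)) + ε (toS (x 1)) (toS (x 2)) +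
          ε (toS (x 2)) (toS (x 3)) + ε (toS (x 3)) (toS (x 0))) = 0 by omega
      rw [mul_add, mul_add, mul_add, s0, s1, s2, s3]
      have weak : ∀ {k l : ℕ}, ((pp (x k) = pp (x l) ∧ t (x k) = t (x l)) ∨
          (pp (x l) = - pp (x k) ∧ ∃ i, x l = x k + ee i)) →
          ((pp (x k) = pp (x l) ∧ t (x k) = t (x l)) ∨ pp (x l) = - pp (x k)) :=
        fun h => h.imp id And.left
      have d0 := weak c0
      have d1 := weak c1
      have d2 := weak c2
      have d3 := weak c3
      rcases c0 with ⟨p0, q0⟩ | ⟨p0, i0, e0⟩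
      · rw [p0, q0] at d3 ⊢
        linear_combination cyc3 (pp_sq (x 1)) d1 d2 d3
      rcases c1 with ⟨p1, q1⟩ | ⟨p1, i1, e1⟩
      · rw [p1, q1] at d0 ⊢
        linear_combination cyc3 (pp_sq (x 0)) d0 d2 d3
      rcases c2 with ⟨p2, q2⟩ | ⟨p2, i2, e2⟩
      · rw [p2, q2] at d1 ⊢
        linear_combination cyc3 (pp_sq (x 0)) d0 d1 d3
      rcases c3 with ⟨p3, q3⟩ | ⟨p3, i3, e3⟩
      · rw [p3, q3] at d2 ⊢
        linear_combination cyc3 (pp_sq (x 0)) d0 d1 d2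
      · have hn02 : x 0 ≠ x 2 := fun h => by
          have := hinj 0 2 (by norm_num) (by norm_num) h; omega
        have hn13 : x 1 ≠ x 3 := fun h => by
          have := hinj 1 3 (by norm_num) (by norm_num) h; omega
        have e3' : x 3 = x 0 + ee i3 := by rw [e3, ee_cancel]
        have hi01 : i1 ≠ i0 := by
          rintro rfl
          exact hn02 (by rw [e1, e0, ee_cancel])
        have hi03 : i0 ≠ i3 := by
          rintro rfl
          exact hn13 (by rw [e0, e3'])
        have e2' : x 0 + ee i0 + ee i1 + ee i2 = x 0 + ee i3 := by
          rw [← e0, ← e1, ← e2, e3']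
        have hi13 : i1 = i3 := by
          by_contra hne
          have f1 := congrFun e2' i3
          have f0 := congrFun e2' i0
          rw [ee_self (x 0) i3] at f1
          rw [ee_ne (x 0) hi03] at f0
          have g3 : i3 = i2 := by
            by_contra h
            rw [ee_ne _ h, ee_ne _ (Ne.symm hne), ee_ne _ hi03.symm] at f1
            exact z2_ne _ f1.symm
          rw [← g3, ee_ne _ hi03, ee_ne _ hi01.symm, ee_self] at f0
          exact z2_ne _ f0
        have b0 := hbm 0 (by norm_num); have b1 := hbm 1 (by norm_num)
        have b2 := hbm 2 (by norm_num); have b3 := hbm 3 (by norm_num)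
        have hx2 : x 2 = x 0 + ee i0 + ee i3 := by rw [e1, e0, hi13]
        have hsq := ht.sq (x 0) i0 i3 hi03 b0 (e0 ▸ b1) (e3' ▸ b3) (hx2 ▸ b2)
        rw [← hx2, ← e0, ← e3'] at hsq
        have pe2 : pp (x 2) = pp (x 0) := by omega
        have pe3 : pp (x 3) = - pp (x 0) := by omega
        rw [pe2, pe3, p0]
        have : (t (x 0) - t (x 2)) * (t (x 1) - t (x 3)) = 0 := by
          rcases hsq with h | h <;> rw [h] <;> ring
        linear_combination 2 * pp (x 0) * this
  · apply Finset.sum_eq_zero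
    intro k hk
    apply h0
    intro hsh
    obtain ⟨-, -, i, hi⟩ := (short_iff hB).mp hsh
    exact hex ⟨k, Finset.mem_range.mp hk, i, hi⟩


/-! ### Two-dimensional faces from small cubes -/

lemma poly_le {n : ℕ} {ℬ : Finset (Finset (JJ n))} (hB : ∀ C ∈ ℬ, ∃ x, toS x = C)
    (L : (Fin n → ℝ) →ₗ[ℝ] ℝ) (c : ℝ)
    (h : ∀ x : VV n, toS x ∈ ℬ → L (eSet (toS x)) ≤ c) :
    ∀ y ∈ matroidPolytope ℬ, L y ≤ c := by
  have hconv : Convex ℝ {y | L y ≤ c} := convex_halfSpace_le L.isLinear c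
  have : matroidPolytope ℬ ⊆ {y | L y ≤ c} := by
    apply convexHull_min _ hconv
    rintro _ ⟨C, hC, rfl⟩
    obtain ⟨x, rfl⟩ := hB C hC
    exact h x hC
  exact fun y hy => this hy

noncomputable def wK {n : ℕ} (K : Finset (Fin n)) : Fin n → ℝ := fun k => if k ∈ K then 0 else 1

noncomputable def FK {n : ℕ} (ℬ : Finset (Finset (JJ n))) (A : VV n) (K : Finset (Fin n)) :
    Set (Fin n → ℝ) :=
  {x ∈ matroidPolytope ℬ | ∀ y ∈ matroidPolytope ℬ, Lof (lw A (wK K)) y ≤ Lof (lw A (wK K)) x}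

lemma FK_exposed {n : ℕ} (ℬ : Finset (Finset (JJ n))) (A : VV n) (K : Finset (Fin n)) :
    IsExposed ℝ (matroidPolytope ℬ) (FK ℬ A K) := by
  intro _
  exact ⟨LinearMap.toContinuousLinearMap (Lof (lw A (wK K))), rfl⟩

lemma vert_mem {n : ℕ} {ℬ : Finset (Finset (JJ n))} {C : Finset (JJ n)} (h : C ∈ ℬ) :
    eSet C ∈ matroidPolytope ℬ := subset_convexHull ℝ _ ⟨C, h, rfl⟩

lemma FK_top {n : ℕ} {ℬ : Finset (Finset (JJ n))} (hB : ∀ C ∈ ℬ, ∃ x, toS x = C)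
    (A : VV n) (K : Finset (Fin n)) :
    ∀ y ∈ matroidPolytope ℬ, Lof (lw A (wK K)) y ≤ Lof (lw A (wK K)) (eSet (toS A)) := by
  apply poly_le hB
  intro x _
  rw [Lof_toS, Lof_toS, ← sub_nonneg, gap]
  apply Finset.sum_nonneg
  intro k _
  unfold wK
  split_ifs <;> norm_num

lemma FK_of_agree {n : ℕ} {ℬ : Finset (Finset (JJ n))} (hB : ∀ C ∈ ℬ, ∃ x, toS x = C)
    {A C : VV n} {K : Finset (Fin n)} (hC : toS C ∈ ℬ) (h : ∀ k, k ∉ K → A k = C k) :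
    eSet (toS C) ∈ FK ℬ A K := by
  refine ⟨vert_mem hC, fun y hy => (FK_top hB A K y hy).trans ?_⟩
  rw [Lof_toS, Lof_toS, ← sub_nonpos, gap]
  apply le_of_eq
  apply Finset.sum_eq_zero
  intro k _
  by_cases hk : k ∈ K
  · simp [wK, hk]
  · rw [if_pos (h k hk)]

lemma FK_coord {n : ℕ} {ℬ : Finset (Finset (JJ n))} (hB : ∀ C ∈ ℬ, ∃ x, toS x = C)
    {A : VV n} {K : Finset (Fin n)} (hA : toS A ∈ ℬ) {y : Fin n → ℝ} (hy : y ∈ FK ℬ A K) :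
    ∀ k, k ∉ K → y k = sg (A k) := by
  have h1 := hy.2 _ (vert_mem hA)
  rw [Lof_apply, Lof_apply] at h1
  have hb : ∀ k, sg (A k) * y k ≤ 1 := by
    intro k
    have := poly_le hB (sg (A k) • LinearMap.proj k) 1 (by
      intro x _
      simp only [LinearMap.smul_apply, LinearMap.proj_apply, smul_eq_mul, eSet_toS]
      by_cases h : A k = x k
      · rw [h, sg_sq]
      · rw [sg_ne h]; have := sg_sq (A k); linarith) y hy.1
    simpa using this
  have h2 : ∑ k, wK K k * (1 - sg (A k) * y k) ≤ 0 := by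
    have : ∑ k, wK K k * (1 - sg (A k) * y k) =
        ∑ k, lw A (wK K) k * eSet (toS A) k - ∑ k, lw A (wK K) k * y k := by
      rw [← Finset.sum_sub_distrib]
      refine Finset.sum_congr rfl fun k _ => ?_
      rw [eSet_toS, lw]
      linear_combination - wK K k * sg_sq (A k)
    rw [this]; linarith
  have hnn : ∀ k ∈ Finset.univ, 0 ≤ wK K k * (1 - sg (A k) * y k) := by
    intro k _
    apply mul_nonneg
    · unfold wK; split_ifs <;> norm_num
    · linarith [hb k]
  have h3 := (Finset.sum_eq_zero_iff_of_nonneg hnn).mp (le_antisymm h2 (Finset.sum_nonneg hnn))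
  intro k hk
  have := h3 k (Finset.mem_univ k)
  simp only [wK, if_neg hk, one_mul] at this
  linear_combination y k * (-sg_sq (A k)) - sg (A k) * this

lemma FK_agree {n : ℕ} {ℬ : Finset (Finset (JJ n))} (hB : ∀ C ∈ ℬ, ∃ x, toS x = C)
    {A C : VV n} {K : Finset (Fin n)} (hA : toS A ∈ ℬ) (hy : eSet (toS C) ∈ FK ℬ A K) :
    ∀ k, k ∉ K → A k = C k := by
  intro k hk
  have := FK_coord hB hA hy k hk
  rw [eSet_toS] at this
  exact (sg_inj this).symm

lemma FK_two {n : ℕ} {ℬ : Finset (Finset (JJ n))} (A : VV n) (K : Finset (Fin n))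
    (hA : eSet (toS A) ∈ FK ℬ A K) (u v : Fin n → ℝ) (hind : LinearIndependent ℝ ![u, v])
    (hP : ∀ y ∈ FK ℬ A K, ∃ a c : ℝ, y - eSet (toS A) = a • u + c • v)
    (hu : u ∈ vectorSpan ℝ (FK ℬ A K)) (hv : v ∈ vectorSpan ℝ (FK ℬ A K)) :
    Is2Face ℬ (FK ℬ A K) := by
  refine ⟨FK_exposed _ _ _, ?_⟩
  have : vectorSpan ℝ (FK ℬ A K) = Submodule.span ℝ (Set.range ![u, v]) := by
    apply le_antisymm
    · rw [vectorSpan_eq_span_vsub_set_right ℝ hA, Submodule.span_le]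
      rintro _ ⟨y, hy, rfl⟩
      obtain ⟨a, c, h⟩ := hP y hy
      simp only [vsub_eq_sub, h]
      apply Submodule.add_mem
      · exact Submodule.smul_mem _ _ (Submodule.subset_span ⟨0, rfl⟩)
      · exact Submodule.smul_mem _ _ (Submodule.subset_span ⟨1, rfl⟩)
    · rw [Submodule.span_le]
      rintro _ ⟨l, rfl⟩
      fin_cases l
      · exact hu
      · exact hv
  rw [this, finrank_span_eq_card hind]
  simp

lemma single_mem {n : ℕ} {S : Set (Fin n → ℝ)} {X : VV n} {i : Fin n}
    (h1 : eSet (toS X) ∈ S) (h2 : eSet (toS (X + ee i)) ∈ S) :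
    (Pi.single i 1 : Fin n → ℝ) ∈ vectorSpan ℝ S := by
  have h := Submodule.smul_mem _ (sg (X i) / 2) (vsub_mem_vectorSpan ℝ h1 h2)
  convert h using 1
  ext k
  simp only [Pi.smul_apply, vsub_eq_sub, Pi.sub_apply, eSet_toS, smul_eq_mul, Pi.single_apply]
  by_cases hk : k = i
  · subst hk
    rw [if_pos rfl, ee_self, sg_flip]
    have := sg_sq (X k)
    linarith
  · rw [if_neg hk, ee_ne _ hk]; ring

lemma sum3 {n : ℕ} {ℬ : Finset (Finset (JJ n))} {ε : Finset (JJ n) → Finset (JJ n) → ℤ}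
    (hε : IsPolytopeOrientation ℬ ε) (hB : ∀ C ∈ ℬ, ∃ x, toS x = C)
    {Fc : Set (Fin n → ℝ)} (h2 : Is2Face ℬ Fc) (a b c : VV n)
    (ma : eSet (toS a) ∈ Fc) (mb : eSet (toS b) ∈ Fc) (mc : eSet (toS c) ∈ Fc)
    (hcov : ∀ C, toS C ∈ ℬ → eSet (toS C) ∈ Fc → C = a ∨ C = b ∨ C = c)
    (e0 : IsEdge ℬ (toS a) (toS b)) (e1 : IsEdge ℬ (toS b) (toS c))
    (e2 : IsEdge ℬ (toS c) (toS a)) :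
    ε (toS a) (toS b) + ε (toS b) (toS c) + ε (toS c) (toS a) = 0 := by
  set v : ℕ → Finset (JJ n) := fun k => if k = 0 then toS a else if k = 1 then toS b else toS c
    with hv
  have v0 : v 0 = toS a := by simp [hv]
  have v1 : v 1 = toS b := by simp [hv]
  have v2 : v 2 = toS c := by simp [hv]
  have hF : FaceCycle ℬ Fc 3 v := by
    refine ⟨h2, le_rfl, ?_, ?_, ?_⟩
    · intro i hi
      interval_cases i
      · rw [v0]; exact ⟨e0.1, ma⟩
      · rw [v1]; exact ⟨e1.1, mb⟩
      · rw [v2]; exact ⟨e2.1, mc⟩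
    · intro A hA hm
      obtain ⟨C, rfl⟩ := hB A hA
      have n0 := e0.2.2.1
      have n1 := e1.2.2.1
      have n2 := e2.2.2.1
      rcases hcov C hA hm with rfl | rfl | rfl
      · refine ⟨0, ⟨by norm_num, v0⟩, ?_⟩
        rintro j ⟨hj, hj'⟩
        interval_cases j
        · rfl
        · rw [v1] at hj'; exact absurd hj'.symm n0
        · rw [v2] at hj'; exact absurd hj' n2
      · refine ⟨1, ⟨by norm_num, v1⟩, ?_⟩
        rintro j ⟨hj, hj'⟩
        interval_cases j
        · rw [v0] at hj'; exact absurd hj' n0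
        · rfl
        · rw [v2] at hj'; exact absurd hj'.symm n1
      · refine ⟨2, ⟨by norm_num, v2⟩, ?_⟩
        rintro j ⟨hj, hj'⟩
        interval_cases j
        · rw [v0] at hj'; exact absurd hj'.symm n2
        · rw [v1] at hj'; exact absurd hj' n1
        · rfl
    · intro i hi
      interval_cases i
      · simpa [v0, v1] using e0
      · simpa [v1, v2] using e1
      · simpa [v2, v0] using e2
  have := hε.2.2 Fc 3 v hF
  simpa [Finset.sum_range_succ, v0, v1, v2] using this

lemma sum4 {n : ℕ} {ℬ : Finset (Finset (JJ n))} {ε : Finset (JJ n) → Finset (JJ n) → ℤ}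
    (hε : IsPolytopeOrientation ℬ ε) (hB : ∀ C ∈ ℬ, ∃ x, toS x = C)
    {Fc : Set (Fin n → ℝ)} (h2 : Is2Face ℬ Fc) (a b c d : VV n)
    (ma : eSet (toS a) ∈ Fc) (mb : eSet (toS b) ∈ Fc) (mc : eSet (toS c) ∈ Fc)
    (md : eSet (toS d) ∈ Fc)
    (hcov : ∀ C, toS C ∈ ℬ → eSet (toS C) ∈ Fc → C = a ∨ C = b ∨ C = c ∨ C = d)
    (hac : a ≠ c) (hbd : b ≠ d)
    (e0 : IsEdge ℬ (toS a) (toS b)) (e1 : IsEdge ℬ (toS b) (toS c))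
    (e2 : IsEdge ℬ (toS c) (toS d)) (e3 : IsEdge ℬ (toS d) (toS a)) :
    ε (toS a) (toS b) + ε (toS b) (toS c) + ε (toS c) (toS d) + ε (toS d) (toS a) = 0 := by
  set v : ℕ → Finset (JJ n) := fun k => if k = 0 then toS a else if k = 1 then toS b else
    if k = 2 then toS c else toS d with hv
  have v0 : v 0 = toS a := by simp [hv]
  have v1 : v 1 = toS b := by simp [hv]
  have v2 : v 2 = toS c := by simp [hv]
  have v3 : v 3 = toS d := by simp [hv]
  have hF : FaceCycle ℬ Fc 4 v := by
    refine ⟨h2, by norm_num, ?_, ?_, ?_⟩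
    · intro i hi
      interval_cases i
      · rw [v0]; exact ⟨e0.1, ma⟩
      · rw [v1]; exact ⟨e1.1, mb⟩
      · rw [v2]; exact ⟨e2.1, mc⟩
      · rw [v3]; exact ⟨e3.1, md⟩
    · intro A hA hm
      obtain ⟨C, rfl⟩ := hB A hA
      have n0 := e0.2.2.1
      have n1 := e1.2.2.1
      have n2 := e2.2.2.1
      have n3 := e3.2.2.1
      have n4 : toS a ≠ toS c := fun h => hac (toS_inj h)
      have n5 : toS b ≠ toS d := fun h => hbd (toS_inj h)
      rcases hcov C hA hm with rfl | rfl | rfl | rfl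
      · refine ⟨0, ⟨by norm_num, v0⟩, ?_⟩
        rintro j ⟨hj, hj'⟩
        interval_cases j
        · rfl
        · rw [v1] at hj'; exact absurd hj'.symm n0
        · rw [v2] at hj'; exact absurd hj'.symm n4
        · rw [v3] at hj'; exact absurd hj' n3
      · refine ⟨1, ⟨by norm_num, v1⟩, ?_⟩
        rintro j ⟨hj, hj'⟩
        interval_cases j
        · rw [v0] at hj'; exact absurd hj' n0
        · rfl
        · rw [v2] at hj'; exact absurd hj'.symm n1
        · rw [v3] at hj'; exact absurd hj'.symm n5
      · refine ⟨2, ⟨by norm_num, v2⟩, ?_⟩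
        rintro j ⟨hj, hj'⟩
        interval_cases j
        · rw [v0] at hj'; exact absurd hj' n4
        · rw [v1] at hj'; exact absurd hj' n1
        · rfl
        · rw [v3] at hj'; exact absurd hj'.symm n2
      · refine ⟨3, ⟨by norm_num, v3⟩, ?_⟩
        rintro j ⟨hj, hj'⟩
        interval_cases j
        · rw [v0] at hj'; exact absurd hj'.symm n3
        · rw [v1] at hj'; exact absurd hj' n5
        · rw [v2] at hj'; exact absurd hj' n2
        · rfl
    · intro i hi
      interval_cases i
      · simpa [v0, v1] using e0
      · simpa [v1, v2] using e1
      · simpa [v2, v3] using e2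
      · simpa [v3, v0] using e3
  have := hε.2.2 Fc 4 v hF
  simpa [Finset.sum_range_succ, v0, v1, v2, v3] using this

/-- The vertices agreeing with `A` off `{i, j}`. -/
lemma two_cases {n : ℕ} {A C : VV n} {i j : Fin n} (hij : i ≠ j)
    (h : ∀ k, k ∉ ({i, j} : Finset (Fin n)) → A k = C k) :
    C = A ∨ C = A + ee i ∨ C = A + ee i + ee j ∨ C = A + ee j := by
  have hk : ∀ k, k ≠ i → k ≠ j → C k = A k := fun k h1 h2 => (h k (by simp [h1, h2])).symm
  by_cases hi : A i = C i <;> by_cases hj : A j = C j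
  · left; ext k
    by_cases h1 : k = i
    · rw [h1, hi]
    by_cases h2 : k = j
    · rw [h2, hj]
    exact hk k h1 h2
  · right; right; right; ext k
    by_cases h2 : k = j
    · rw [h2, ee_self, z2_one hj]
    rw [ee_ne _ h2]
    by_cases h1 : k = i
    · rw [h1, hi]
    exact hk k h1 h2
  · right; left; ext k
    by_cases h1 : k = i
    · rw [h1, ee_self, z2_one hi]
    rw [ee_ne _ h1]
    by_cases h2 : k = j
    · rw [h2, hj]
    exact hk k h1 h2
  · right; right; left; ext k
    by_cases h2 : k = j
    · rw [h2, ee_self, ee_ne _ hij.symm, z2_one hj]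
    rw [ee_ne _ h2]
    by_cases h1 : k = i
    · rw [h1, ee_self, z2_one hi]
    rw [ee_ne _ h1]
    exact hk k h1 h2

lemma FK_two_dim {n : ℕ} {ℬ : Finset (Finset (JJ n))} (hB : ∀ C ∈ ℬ, ∃ x, toS x = C)
    {A : VV n} {i j : Fin n} (hij : i ≠ j) (hA : toS A ∈ ℬ) (hi : toS (A + ee i) ∈ ℬ)
    (hj : toS (A + ee i + ee j) ∈ ℬ) : Is2Face ℬ (FK ℬ A {i, j}) := by
  have mA : eSet (toS A) ∈ FK ℬ A {i, j} := FK_of_agree hB hA fun k _ => rfl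
  have mi : eSet (toS (A + ee i)) ∈ FK ℬ A {i, j} := FK_of_agree hB hi fun k hk => by
    simp at hk; rw [ee_ne _ hk.1]
  have mj : eSet (toS (A + ee i + ee j)) ∈ FK ℬ A {i, j} := FK_of_agree hB hj fun k hk => by
    simp at hk; rw [ee_ne _ hk.2, ee_ne _ hk.1]
  apply FK_two A _ mA (Pi.single i 1) (Pi.single j 1)
  · rw [LinearIndependent.pair_iff]
    intro s t h
    have h1 := congrFun h i
    have h2 := congrFun h j
    simp [Pi.single_apply, hij, hij.symm] at h1 h2
    exact ⟨h1, h2⟩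
  · intro y hy
    refine ⟨y i - sg (A i), y j - sg (A j), ?_⟩
    have hc := FK_coord hB hA hy
    ext k
    simp only [Pi.sub_apply, eSet_toS, Pi.add_apply, Pi.smul_apply, Pi.single_apply, smul_eq_mul]
    by_cases h1 : k = i
    · subst h1; simp [hij]
    by_cases h2 : k = j
    · subst h2; simp [h1]
    rw [hc k (by simp [h1, h2])]
    simp [h1, h2]
  · exact single_mem mA mi
  · exact single_mem mi mj

lemma isEdge_symm {n : ℕ} {ℬ : Finset (Finset (JJ n))} {A B : Finset (JJ n)}
    (h : IsEdge ℬ A B) : IsEdge ℬ B A := by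
  obtain ⟨h1, h2, h3, L, h4, h5⟩ := h
  exact ⟨h2, h1, h3.symm, L, h4.symm, fun C hC ha hb => h4 ▸ h5 C hC hb ha⟩

lemma eps_long {n : ℕ} {ℬ : Finset (Finset (JJ n))} {ε : Finset (JJ n) → Finset (JJ n) → ℤ}
    (hε : IsPolytopeOrientation ℬ ε) (hB : ∀ C ∈ ℬ, ∃ x, toS x = C) {A : VV n} {i j : Fin n}
    (hij : i ≠ j) : ε (toS A) (toS (A + ee i + ee j)) = 0 ∧
      ε (toS (A + ee i + ee j)) (toS A) = 0 := by
  constructor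
  · apply hε.2.1
    intro h
    obtain ⟨-, -, q, e⟩ := (short_iff hB).mp h
    exact e_two_ne_one hij e
  · apply hε.2.1
    intro h
    obtain ⟨-, -, q, e⟩ := (short_iff hB).mp h
    apply e_two_ne_one (A := A) (k := q) hij
    nth_rewrite 2 [e]
    rw [ee_cancel]

lemma tri_sum {n : ℕ} {ℬ : Finset (Finset (JJ n))} {ε : Finset (JJ n) → Finset (JJ n) → ℤ}
    (hε : IsPolytopeOrientation ℬ ε) (hB : ∀ C ∈ ℬ, ∃ x, toS x = C) {A : VV n} {i j : Fin n}
    (hij : i ≠ j) (hA : toS A ∈ ℬ) (hi : toS (A + ee i) ∈ ℬ)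
    (hj : toS (A + ee i + ee j) ∈ ℬ) (hn : toS (A + ee j) ∉ ℬ) :
    ε (toS A) (toS (A + ee i)) + ε (toS (A + ee i)) (toS (A + ee i + ee j)) = 0 := by
  have := sum3 hε hB (FK_two_dim hB hij hA hi hj) A (A + ee i) (A + ee i + ee j)
    (FK_of_agree hB hA fun k _ => rfl)
    (FK_of_agree hB hi fun k hk => by simp at hk; rw [ee_ne _ hk.1])
    (FK_of_agree hB hj fun k hk => by simp at hk; rw [ee_ne _ hk.2, ee_ne _ hk.1])
    (by
      intro C hC hm
      rcases two_cases hij (FK_agree hB hA hm) with h | h | h | h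
      · exact Or.inl h
      · exact Or.inr (Or.inl h)
      · exact Or.inr (Or.inr h)
      · exact absurd (h ▸ hC) hn)
    (edge_short hA hi hB) (edge_short hi hj hB)
    (isEdge_symm (edge_long hij hA hj hB fun h => hn h.2))
  rw [(eps_long hε hB hij).2] at this
  simpa using this

lemma sq_sum {n : ℕ} {ℬ : Finset (Finset (JJ n))} {ε : Finset (JJ n) → Finset (JJ n) → ℤ}
    (hε : IsPolytopeOrientation ℬ ε) (hB : ∀ C ∈ ℬ, ∃ x, toS x = C) {A : VV n} {i j : Fin n}
    (hij : i ≠ j) (hA : toS A ∈ ℬ) (hi : toS (A + ee i) ∈ ℬ)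
    (hj : toS (A + ee i + ee j) ∈ ℬ) (hn : toS (A + ee j) ∈ ℬ) :
    ε (toS A) (toS (A + ee i)) + ε (toS (A + ee i)) (toS (A + ee i + ee j)) +
    ε (toS (A + ee i + ee j)) (toS (A + ee j)) + ε (toS (A + ee j)) (toS A) = 0 := by
  have e : A + ee i + ee j = A + ee j + ee i := by abel
  refine sum4 hε hB (FK_two_dim hB hij hA hi hj) A (A + ee i) (A + ee i + ee j) (A + ee j)
    (FK_of_agree hB hA fun k _ => rfl)
    (FK_of_agree hB hi fun k hk => by simp at hk; rw [ee_ne _ hk.1])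
    (FK_of_agree hB hj fun k hk => by simp at hk; rw [ee_ne _ hk.2, ee_ne _ hk.1])
    (FK_of_agree hB hn fun k hk => by simp at hk; rw [ee_ne _ hk.2])
    (fun C hC hm => two_cases hij (FK_agree hB hA hm)) ?_ ?_
    (edge_short hA hi hB) (edge_short hi hj hB)
    (isEdge_symm (by rw [e] at hj ⊢; exact edge_short hn hj hB))
    (isEdge_symm (edge_short hA hn hB))
  · intro h
    have := congrFun h j
    rw [ee_self, ee_ne _ hij.symm] at this
    exact z2_ne _ this.symm
  · intro h
    have := congrFun h j
    rw [ee_self, ee_ne _ hij.symm] at this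
    exact z2_ne _ this.symm


lemma rect_cases {n : ℕ} {ℬ : Finset (Finset (JJ n))} {A C : VV n} {i j k : Fin n}
    (hij : i ≠ j)
    (h : ∀ l, l ∉ ({i, j, k} : Finset (Fin n)) → A l = C l) (hC : toS C ∈ ℬ)
    (n1 : toS (A + ee j) ∉ ℬ) (n2 : toS (A + ee k) ∉ ℬ)
    (n3 : toS (A + ee i + ee j) ∉ ℬ) (n4 : toS (A + ee i + ee k) ∉ ℬ) :
    C = A ∨ C = A + ee i ∨ C = A + ee i + ee j + ee k ∨ C = A + ee j + ee k := by
  by_cases hk : A k = C k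
  · have h' : ∀ l, l ∉ ({i, j} : Finset (Fin n)) → A l = C l := by
      intro l hl
      by_cases hlk : l = k
      · rw [hlk, hk]
      · simp at hl
        exact h l (by simp [hl, hlk])
    rcases two_cases hij h' with e | e | e | e
    · exact Or.inl e
    · exact Or.inr (Or.inl e)
    · exact absurd (e ▸ hC) n3
    · exact absurd (e ▸ hC) n1
  · have h' : ∀ l, l ∉ ({i, j} : Finset (Fin n)) → (A + ee k) l = C l := by
      intro l hl
      by_cases hlk : l = k
      · rw [hlk, ee_self, z2_one hk]
      · simp at hl
        rw [ee_ne _ hlk]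
        exact h l (by simp [hl, hlk])
    rcases two_cases hij h' with e | e | e | e
    · exact absurd (e ▸ hC) n2
    · have e' : A + ee k + ee i = A + ee i + ee k := by abel
      rw [e'] at e
      exact absurd (e ▸ hC) n4
    · right; right; left; rw [e]; abel
    · right; right; right; rw [e]; abel

lemma rect_sum {n : ℕ} {ℬ : Finset (Finset (JJ n))} {ε : Finset (JJ n) → Finset (JJ n) → ℤ}
    (hε : IsPolytopeOrientation ℬ ε) (hB : ∀ C ∈ ℬ, ∃ x, toS x = C) {A : VV n} {i j k : Fin n}
    (hij : i ≠ j) (hik : i ≠ k) (hjk : j ≠ k) (hA : toS A ∈ ℬ) (hi : toS (A + ee i) ∈ ℬ)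
    (hjk' : toS (A + ee j + ee k) ∈ ℬ) (hijk : toS (A + ee i + ee j + ee k) ∈ ℬ)
    (n1 : toS (A + ee j) ∉ ℬ) (n2 : toS (A + ee k) ∉ ℬ)
    (n3 : toS (A + ee i + ee j) ∉ ℬ) (n4 : toS (A + ee i + ee k) ∉ ℬ) :
    ε (toS A) (toS (A + ee i)) +
    ε (toS (A + ee i + ee j + ee k)) (toS (A + ee j + ee k)) = 0 := by
  have mA : eSet (toS A) ∈ FK ℬ A {i, j, k} := FK_of_agree hB hA fun l _ => rfl
  have mi : eSet (toS (A + ee i)) ∈ FK ℬ A {i, j, k} := FK_of_agree hB hi fun l hl => by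
    simp at hl; rw [ee_ne _ hl.1]
  have mjk : eSet (toS (A + ee j + ee k)) ∈ FK ℬ A {i, j, k} :=
    FK_of_agree hB hjk' fun l hl => by
      simp at hl; rw [ee_ne _ hl.2.2, ee_ne _ hl.2.1]
  have mijk : eSet (toS (A + ee i + ee j + ee k)) ∈ FK ℬ A {i, j, k} :=
    FK_of_agree hB hijk fun l hl => by
      simp at hl; rw [ee_ne _ hl.2.2, ee_ne _ hl.2.1, ee_ne _ hl.1]
  have hcov : ∀ C, toS C ∈ ℬ → (∀ l, l ∉ ({i, j, k} : Finset (Fin n)) → A l = C l) →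
      C = A ∨ C = A + ee i ∨ C = A + ee i + ee j + ee k ∨ C = A + ee j + ee k :=
    fun C hC h => rect_cases hij h hC n1 n2 n3 n4
  -- the two extra linear inequalities
  have ineq : ∀ c : ℝ, (c = 1 ∨ c = -1) → ∀ y ∈ FK ℬ A {i, j, k},
      c * (sg (A j) * y j - sg (A k) * y k) ≤ 0 := by
    intro c hc y hy
    set L : (Fin n → ℝ) →ₗ[ℝ] ℝ := (c * sg (A j)) • LinearMap.proj j -
      (c * sg (A k)) • LinearMap.proj k + Lof (lw A (wK {i, j, k})) with hL
    have hLv : ∀ y, L y = c * (sg (A j) * y j - sg (A k) * y k) + Lof (lw A (wK {i, j, k})) y := by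
      intro y; simp [hL]; ring
    have key := poly_le hB L (Lof (lw A (wK {i, j, k})) (eSet (toS A))) (by
      intro C hC
      rw [hLv, Lof_toS, Lof_toS, eSet_toS, eSet_toS]
      suffices c * (sg (A j) * sg (C j) - sg (A k) * sg (C k)) ≤
        vl (lw A (wK {i, j, k})) A - vl (lw A (wK {i, j, k})) C by linarith
      rw [gap]
      have hnn : ∀ l ∈ Finset.univ,
          (0 : ℝ) ≤ if A l = C l then 0 else 2 * wK {i, j, k} l := by
        intro l _
        unfold wK
        split_ifs <;> norm_num
      have hv : ∀ l, sg (A l) * sg (C l) = 1 ∨ sg (A l) * sg (C l) = -1 := by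
        intro l
        by_cases h : A l = C l
        · left; rw [h, sg_sq]
        · right; rw [sg_ne h]; have := sg_sq (A l); linarith
      by_cases hag : ∀ l, l ∉ ({i, j, k} : Finset (Fin n)) → A l = C l
      · have hz : sg (A j) * sg (C j) = sg (A k) * sg (C k) := by
          rcases hcov C hC hag with rfl | rfl | rfl | rfl
          · rw [sg_sq, sg_sq]
          · rw [ee_ne _ hij.symm, ee_ne _ hik.symm, sg_sq, sg_sq]
          · rw [ee_ne _ hjk, ee_self, ee_ne _ hij.symm, ee_self, ee_ne _ hjk.symm,
              ee_ne _ hik.symm, sg_flip, sg_flip]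
            have := sg_sq (A j); have := sg_sq (A k); linarith
          · rw [ee_ne _ hjk, ee_self, ee_self, ee_ne _ hjk.symm, sg_flip, sg_flip]
            have := sg_sq (A j); have := sg_sq (A k); linarith
        rw [hz, sub_self, mul_zero]
        exact Finset.sum_nonneg hnn
      · push Not at hag
        obtain ⟨l, hl, hne⟩ := hag
        have h2 := Finset.single_le_sum hnn (Finset.mem_univ l)
        rw [if_neg hne] at h2
        have : wK {i, j, k} l = 1 := by rw [wK, if_neg hl]
        rw [this] at h2
        refine le_trans ?_ h2
        rcases hc with rfl | rfl <;> rcases hv j with h | h <;> rcases hv k with h' | h' <;>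
          rw [h, h'] <;> norm_num) y hy.1
    rw [hLv] at key
    have := hy.2 _ (vert_mem hA)
    linarith
  have hP : ∀ y ∈ FK ℬ A {i, j, k}, sg (A j) * y j = sg (A k) * y k := by
    intro y hy
    have h1 := ineq 1 (Or.inl rfl) y hy
    have h2 := ineq (-1) (Or.inr rfl) y hy
    linarith
  have hface : Is2Face ℬ (FK ℬ A {i, j, k}) := by
    have hv := Submodule.smul_mem _ (1/2 : ℝ) (vsub_mem_vectorSpan ℝ mA mjk)
    have hV : ∀ l, ((1/2 : ℝ) • (eSet (toS A) -ᵥ eSet (toS (A + ee j + ee k)))) l =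
        1/2 * (sg (A l) - sg ((A + ee j + ee k) l)) := by
      intro l
      rw [Pi.smul_apply, vsub_eq_sub, Pi.sub_apply, eSet_toS, eSet_toS, smul_eq_mul]
    generalize (1/2 : ℝ) • (eSet (toS A) -ᵥ eSet (toS (A + ee j + ee k))) = V at hv hV
    refine FK_two A _ mA (Pi.single i 1) V ?_ ?_ (single_mem mA mi) hv
    · rw [LinearIndependent.pair_iff]
      intro s t h
      have h1 := congrFun h i
      have h2 := congrFun h j
      rw [Pi.add_apply, Pi.smul_apply, Pi.smul_apply, smul_eq_mul, smul_eq_mul, Pi.single_apply,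
        Pi.zero_apply, hV] at h1 h2
      rw [if_pos rfl, ee_ne _ hik, ee_ne _ hij] at h1
      rw [if_neg hij.symm, ee_ne _ hjk, ee_self, sg_flip] at h2
      have h3 : t = 0 := by
        linear_combination sg (A j) * h2 - t * sg_sq (A j)
      exact ⟨by linarith, h3⟩
    · intro y hy
      have hc := FK_coord hB hA hy
      have hjk2 := hP y hy
      refine ⟨y i - sg (A i), sg (A j) * y j - 1, ?_⟩
      ext l
      rw [Pi.sub_apply, Pi.add_apply, Pi.smul_apply, Pi.smul_apply, smul_eq_mul, smul_eq_mul,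
        Pi.single_apply, hV, eSet_toS]
      by_cases h1 : l = i
      · subst h1
        rw [if_pos rfl, ee_ne _ hik, ee_ne _ hij]; ring
      rw [if_neg h1]
      by_cases h2 : l = j
      · subst h2
        rw [ee_ne _ hjk, ee_self, sg_flip]
        linear_combination (-y l) * sg_sq (A l)
      by_cases h3 : l = k
      · subst h3
        rw [ee_self, ee_ne _ h2, sg_flip]
        linear_combination (-y l) * sg_sq (A l) - sg (A l) * hjk2
      · rw [ee_ne _ h3, ee_ne _ h2, hc l (by simp [h1, h2, h3])]; ring
  have e : A + ee i + ee j + ee k = A + ee j + ee k + ee i := by abel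
  have := sum4 hε hB hface A (A + ee i) (A + ee i + ee j + ee k) (A + ee j + ee k)
    mA mi mijk mjk (fun C hC hm => hcov C hC (FK_agree hB hA hm))
    (by
      intro h
      have := congrFun h k
      rw [ee_self, ee_ne _ hjk.symm, ee_ne _ hik.symm] at this
      exact z2_ne _ this.symm)
    (by
      intro h
      have := congrFun h k
      rw [ee_self, ee_ne _ hjk.symm, ee_ne _ hik.symm] at this
      exact z2_ne _ this.symm)
    (edge_short hA hi hB)
    (edge_long hjk hi hijk hB fun h => n3 h.1)
    (isEdge_symm (by rw [e] at hijk ⊢; exact edge_short hjk' hijk hB))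
    (isEdge_symm (edge_long hjk hA hjk' hB fun h => n1 h.1))
  rw [(eps_long hε hB hjk).2, (eps_long hε hB hjk).1] at this
  simpa using this

lemma eps_pm {n : ℕ} {ℬ : Finset (Finset (JJ n))} {ε : Finset (JJ n) → Finset (JJ n) → ℤ}
    (hε : IsPolytopeOrientation ℬ ε) (hB : ∀ C ∈ ℬ, ∃ x, toS x = C) {A : VV n} {i : Fin n}
    (hA : toS A ∈ ℬ) (hi : toS (A + ee i) ∈ ℬ) :
    (ε (toS A) (toS (A + ee i)) = 1 ∨ ε (toS A) (toS (A + ee i)) = -1) ∧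
      ε (toS (A + ee i)) (toS A) = - ε (toS A) (toS (A + ee i)) :=
  hε.1 _ _ ((short_iff hB).mpr ⟨hA, hi, i, rfl⟩)

lemma goodD_of_poly {n : ℕ} {ℬ : Finset (Finset (JJ n))}
    {ε : Finset (JJ n) → Finset (JJ n) → ℤ}
    (hε : IsPolytopeOrientation ℬ ε) (hB : ∀ C ∈ ℬ, ∃ x, toS x = C) :
    GoodD (fun x : VV n => toS x ∈ ℬ) (fun A i => ε (toS A) (toS (A + ee i)) * pp A) := by
  refine ⟨?_, ?_, ?_, ?_, ?_⟩
  · intro A i hA hi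
    have h1 := (eps_pm hε hB hA hi).1
    have h2 := pp_sq A
    rcases h1 with h | h <;> simp only [h] <;> linarith
  · intro A i hA hi
    have h1 := (eps_pm hε hB hA hi).2
    simp only [ee_cancel, h1, pp_flip]; ring
  · intro A i j hij hA hi hj hn
    have := tri_sum hε hB hij hA hi hj hn
    simp only [pp_flip]
    linear_combination pp A * this
  · intro A i j hij hA hi hj hn
    have hs := sq_sum hε hB hij hA hi hj hn
    have e : A + ee i + ee j = A + ee j + ee i := by abel
    have hj' : toS (A + ee j + ee i) ∈ ℬ := e ▸ hj
    have q0 := eps_pm hε hB hA hi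
    have q1 := eps_pm hε hB hi hj
    have q2 := eps_pm hε hB hn hj'
    have q3 := eps_pm hε hB hA hn
    rw [e, q2.2, q3.2] at hs
    simp only [pp_flip]
    rw [e] at q1 ⊢
    rcases q0.1 with h0 | h0 <;> rcases q1.1 with h1 | h1 <;> rcases q2.1 with h2 | h2 <;>
      rcases q3.1 with h3 | h3 <;> rw [h0, h1, h2, h3] at hs ⊢ <;> first | (exfalso; omega) | ring
  · intro A i j k hij hik hjk hA hi hjk' hijk n1 n2 n3 n4
    have hs := rect_sum hε hB hij hik hjk hA hi hjk' hijk n1 n2 n3 n4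
    have e : A + ee i + ee j + ee k = A + ee j + ee k + ee i := by abel
    have hijk' : toS (A + ee j + ee k + ee i) ∈ ℬ := e ▸ hijk
    have q := eps_pm hε hB hjk' hijk'
    rw [e, q.2] at hs
    simp only [pp_flip]
    linear_combination pp A * hs

lemma exists_pt_of_poly {n : ℕ} {ℬ : Finset (Finset (JJ n))}
    (hE : Exch (fun x : VV n => toS x ∈ ℬ))
    {ε : Finset (JJ n) → Finset (JJ n) → ℤ}
    (hε : IsPolytopeOrientation ℬ ε) (hB : ∀ C ∈ ℬ, ∃ x, toS x = C)
    {F : VV n} (hF : toS F ∈ ℬ) :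
    ∃ t, Pt ℬ t ∧ ∀ A i, toS A ∈ ℬ → toS (A + ee i) ∈ ℬ →
      ε (toS A) (toS (A + ee i)) = t A * t (A + ee i) * pp A := by
  obtain ⟨t, ht⟩ := homotopy hE (goodD_of_poly hε hB) _ Finset.univ F rfl hF
  have hR : ∀ X, face F Finset.univ X := by intro X; simp [face]
  have hst : ∀ A i, toS A ∈ ℬ → toS (A + ee i) ∈ ℬ →
      ε (toS A) (toS (A + ee i)) = t A * t (A + ee i) * pp A := by
    intro A i hA hi
    rw [ht.short A i (hR _) (hR _) hA hi]
    linear_combination - ε (toS A) (toS (A + ee i)) * pp_sq A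
  refine ⟨t, ⟨fun A _ => ht.one A, ?_, ?_⟩, hst⟩
  · intro A i j hij hA hj hn
    exact ht.long A i j hij (hR _) (hR _) hA hj hn
  · intro A i j hij hA hi hj hij'
    have hs := sq_sum hε hB hij hA hi hij' hj
    have e : A + ee i + ee j = A + ee j + ee i := by abel
    have hj' : toS (A + ee j + ee i) ∈ ℬ := e ▸ hij'
    rw [hst _ _ hA hi, hst _ _ hi hij', (eps_pm hε hB hA hj).2, hst _ _ hA hj, e,
      (eps_pm hε hB hj hj').2, hst _ _ hj hj', pp_flip, pp_flip] at hs
    rw [e]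
    have : (t A - t (A + ee j + ee i)) * (t (A + ee i) - t (A + ee j)) = 0 := by
      linear_combination pp A * hs - (t A - t (A + ee j + ee i)) *
        (t (A + ee i) - t (A + ee j)) * pp_sq A
    rcases mul_eq_zero.mp this with h | h
    · left; linarith
    · right; linarith

/-- Every orientation of a Lagrangian matroid `M` is induced from a
unique orientation of its matroid polytope, and conversely every orientation of the
polytope induces a unique orientation of `M`: orientations of the polytope and
orientations of `M` are in one-to-one correspondence. -/
theorem orientations_biject_with_polytope_orientations {n : ℕ}
    (ℬ : Finset (Finset (JJ n))) (hM : IsLagrangianMatroid ℬ) :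
    (∀ s : Finset (JJ n) → Finset (JJ n) → ℤ, IsOrientation ℬ s →
      ∃! ε : Finset (JJ n) → Finset (JJ n) → ℤ,
        IsPolytopeOrientation ℬ ε ∧ InducedBy ℬ ε s) ∧
    (∀ ε : Finset (JJ n) → Finset (JJ n) → ℤ, IsPolytopeOrientation ℬ ε →
      ∃! s : Finset (JJ n) → Finset (JJ n) → ℤ,
        IsOrientation ℬ s ∧ InducedBy ℬ ε s) := by
  have hE := exch_of_lagrangian hM
  have hB : ∀ C ∈ ℬ, ∃ x, toS x = C := fun C hC => ⟨chi C, toS_chi (hM.1 C hC).1 (hM.1 C hC).2⟩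
  obtain ⟨F, hF⟩ : ∃ F : VV n, toS F ∈ ℬ := by
    obtain ⟨A, hA, -⟩ := hM.2 1 (fun _ => rfl)
    obtain ⟨x, rfl⟩ := hB A hA
    exact ⟨x, hA⟩
  constructor
  · intro s hs
    obtain ⟨t, ht, hst⟩ := pt_of_orient hE hB hs hF
    have hval : ∀ A i, toS A ∈ ℬ → toS (A + ee i) ∈ ℬ →
        (fun A B => if IsShortEdge ℬ A B then s A B else 0) (toS A) (toS (A + ee i)) =
          t A * t (A + ee i) * pp A := by
      intro A i hA hi
      have hsh : IsShortEdge ℬ (toS A) (toS (A + ee i)) := (short_iff hB).mpr ⟨hA, hi, i, rfl⟩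
      simp only [if_pos hsh]
      rw [hst _ _ hA hi, kap_one]; ring
    refine ⟨fun A B => if IsShortEdge ℬ A B then s A B else 0, ⟨?_, ?_⟩, ?_⟩
    · exact poly_of_pt hE hB ht hval fun A B h => if_neg h
    · exact induced_of hE hB ht hst hval
    · rintro ε ⟨h1, h2⟩
      funext A B
      by_cases h : IsShortEdge ℬ A B
      · simp only [if_pos h]
        obtain ⟨A, rfl⟩ := hB A h.1.1
        obtain ⟨B, rfl⟩ := hB B h.1.2.1
        obtain ⟨hA, hB', i, rfl⟩ := (short_iff hB).mp h
        exact eps_unique hE hB h1 h2 hA hB'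
      · simp only [if_neg h]
        exact h1.2.1 A B h
  · intro ε hε
    obtain ⟨t, ht, hst⟩ := exists_pt_of_poly hE hε hB hF
    have hor := orient_of_pt hE hB ht
    have hind : InducedBy ℬ ε (sOf ℬ t) :=
      induced_of hE hB ht (fun G A hG hA => sOf_toS t hG hA) hst
    refine ⟨sOf ℬ t, ⟨hor, hind⟩, ?_⟩
    rintro s ⟨h1, h2⟩
    funext G A
    by_cases h : G ∈ ℬ ∧ A ∈ ℬ
    · obtain ⟨hG, hA⟩ := h
      obtain ⟨G, rfl⟩ := hB G hG
      obtain ⟨A, rfl⟩ := hB A hA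
      exact s_unique hE hB h2 hind hG hA
    · rw [not_and_or] at h
      rw [h1.1 G A h, hor.1 G A h]
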